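/- arXiv:2305.14401 — 13 statements merged into one kernel-verified Lean document; each statement's English description precedes it below -/
import Mathlib

section
/- Let G and H be hypomorphic simple graphs on n vertices and let F be a simple graph with 1 ≤ |V(F)| < n. Then the number of subgraphs of G isomorphic to F equals the number of subgraphs of H isomorphic to F (where a subgraph of G is a subset W of vertices together with a subset of the edges of G joining vertices of W), and the number of vertex subsets W of G such that the induced subgraph G[W] is isomorphic to F equals the corresponding number of vertex subsets of H. -/
/-- Two simple graphs on `Fin n` are hypomorphic if some bijection of their vertex
sets matches each vertex-deleted card of one with an isomorphic card of the other. -/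
def GHypomorphic {n : ℕ} (G H : SimpleGraph (Fin n)) : Prop :=
  ∃ σ : Fin n ≃ Fin n, ∀ v : Fin n,
    Nonempty (G.induce ({x | x ≠ v} : Set (Fin n)) ≃g
              H.induce ({y | y ≠ σ v} : Set (Fin n)))

/-- Double counting of the pairs `(v, a)` with `v` outside the support of `a`. -/
theorem sum_card_avoiding {V α : Type*} [Fintype V] [Finite α] {m : ℕ} {p : α → Prop}
    (s : α → Set V) (hs : ∀ a, p a → (s a).ncard = m) :
    ∑ v, Nat.card {a // p a ∧ v ∉ s a} = Nat.card {a // p a} * (Nat.card V - m) := by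
  classical
  have := Fintype.ofFinite α
  let e : (Σ v, {a // p a ∧ v ∉ s a}) ≃ Σ a : {a // p a}, ((s a)ᶜ : Set V) :=
    { toFun := fun x => ⟨⟨x.2.1, x.2.2.1⟩, ⟨x.1, x.2.2.2⟩⟩
      invFun := fun y => ⟨y.2.1, ⟨y.1.1, y.1.2, y.2.2⟩⟩
      left_inv := fun _ => rfl
      right_inv := fun _ => rfl }
  have hcompl (a : {a // p a}) : Nat.card ((s a)ᶜ : Set V) = Nat.card V - m := by
    rw [Nat.card_coe_set_eq, Set.ncard_compl, hs a a.2]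
  rw [← Nat.card_sigma, Nat.card_congr e, Nat.card_sigma, Finset.sum_congr rfl fun a _ => hcompl a,
    Finset.sum_const, Finset.card_univ, smul_eq_mul, Nat.card_eq_fintype_card (α := {a // p a})]

/-- If every member of two finite families has a support of the same size `m < |V|`, and the
number of members avoiding `v` in one family equals the number avoiding `σ v` in the other, then
the families have the same size. -/
theorem card_eq_of_card_avoiding_eq {V α β : Type*} [Finite V] [Finite α] [Finite β] {m : ℕ}
    (hm : m < Nat.card V) {p : α → Prop} {q : β → Prop} (s : α → Set V) (t : β → Set V)
    (hs : ∀ a, p a → (s a).ncard = m) (ht : ∀ b, q b → (t b).ncard = m) (σ : V ≃ V)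
    (h : ∀ v, Nat.card {a // p a ∧ v ∉ s a} = Nat.card {b // q b ∧ σ v ∉ t b}) :
    Nat.card {a // p a} = Nat.card {b // q b} := by
  have := Fintype.ofFinite V
  refine Nat.eq_of_mul_eq_mul_right (Nat.sub_pos_of_lt hm) ?_
  rw [← sum_card_avoiding s hs, ← sum_card_avoiding t ht, Finset.sum_congr rfl fun v _ => h v,
    Equiv.sum_comp σ fun v => Nat.card {b // q b ∧ v ∉ t b}]

namespace SimpleGraph

variable {V W U : Type*} {G : SimpleGraph V} {H : SimpleGraph W}

theorem subgraph_map_injective {f : G →g H} (hf : Function.Injective f) :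
    Function.Injective (Subgraph.map f) := by
  intro K L h
  ext x y
  · rw [← hf.mem_set_image, ← Subgraph.map_verts, h, Subgraph.map_verts, hf.mem_set_image]
  · have hAdj (M : G.Subgraph) : (M.map f).Adj (f x) (f y) ↔ M.Adj x y := by
      simp [Relation.map_apply, hf.eq_iff]
    rw [← hAdj K, h, hAdj L]

/-- The copies of `F` in `G` correspond, along an embedding `e : G ↪g H`, to the copies of `F`
in `H` whose vertices lie in the range of `e`. -/
theorem card_subgraph_iso_eq_card_range (F : SimpleGraph U) (e : G ↪g H) :
    Nat.card {K : G.Subgraph // Nonempty (K.coe ≃g F)} =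
      Nat.card {K : H.Subgraph // Nonempty (K.coe ≃g F) ∧ K.verts ⊆ Set.range e} := by
  have iso (K : G.Subgraph) : K.coe ≃g (K.map e.toHom).coe := e.toCopy.isoSubgraphMap K
  refine Nat.card_eq_of_bijective
    (fun K => ⟨K.1.map e.toHom, K.2.map (iso K.1).symm.trans, Set.image_subset_range _ _⟩) ⟨?_, ?_⟩
  · intro K L h
    exact Subtype.ext (subgraph_map_injective e.injective (congrArg Subtype.val h))
  · rintro ⟨K, hK, hr⟩
    have hmap : (K.comap e.toHom).map e.toHom = K := by
      ext x y
      · exact ⟨by rintro ⟨a, ha, rfl⟩; exact ha, fun hx => by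
          obtain ⟨a, rfl⟩ := hr hx
          exact ⟨a, hx, rfl⟩⟩
      · refine ⟨by rintro ⟨a, b, hab, rfl, rfl⟩; exact hab.2, fun hxy => ?_⟩
        obtain ⟨a, rfl⟩ := hr (K.edge_vert hxy)
        obtain ⟨b, rfl⟩ := hr (K.edge_vert hxy.symm)
        exact ⟨a, b, ⟨e.map_adj_iff.1 (K.adj_sub hxy), hxy⟩, rfl, rfl⟩
    refine ⟨⟨K.comap e.toHom, ?_⟩, Subtype.ext hmap⟩
    rw [← hmap] at hK
    exact hK.map (iso _).trans

/-- The vertex sets inducing `F` in `G` correspond, along an embedding `e : G ↪g H`, to those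
in `H` contained in the range of `e`. -/
theorem card_induce_iso_eq_card_range (F : SimpleGraph U) (e : G ↪g H) :
    Nat.card {s : Set V // Nonempty (G.induce s ≃g F)} =
      Nat.card {s : Set W // Nonempty (H.induce s ≃g F) ∧ s ⊆ Set.range e} := by
  have iso (s : Set V) : G.induce s ≃g H.induce (e '' s) :=
    ⟨Equiv.Set.image e s e.injective, by simp⟩
  refine Nat.card_eq_of_bijective
    (fun s => ⟨e '' s.1, s.2.map (iso s.1).symm.trans, Set.image_subset_range _ _⟩) ⟨?_, ?_⟩
  · intro s t h
    exact Subtype.ext (e.injective.image_injective (congrArg Subtype.val h))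
  · rintro ⟨s, hs, hr⟩
    have himage : e '' (e ⁻¹' s) = s := Set.image_preimage_eq_of_subset hr
    refine ⟨⟨e ⁻¹' s, ?_⟩, Subtype.ext himage⟩
    rw [← himage] at hs
    exact hs.map (iso _).trans

end SimpleGraph

/-- Kelly's lemma: if `G` and `H` are hypomorphic graphs on `n` vertices and `F` is a
graph with `1 ≤ m < n` vertices, then `G` and `H` contain the same number of subgraphs
isomorphic to `F`, and the same number of vertex subsets inducing a subgraph
isomorphic to `F`. -/
theorem stmt0 {n m : ℕ} (hm : 1 ≤ m) (hmn : m < n)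
    (G H : SimpleGraph (Fin n)) (F : SimpleGraph (Fin m))
    (hGH : GHypomorphic G H) :
    Nat.card {K : G.Subgraph // Nonempty (K.coe ≃g F)} =
      Nat.card {K : H.Subgraph // Nonempty (K.coe ≃g F)} ∧
    Nat.card {s : Set (Fin n) // Nonempty (G.induce s ≃g F)} =
      Nat.card {s : Set (Fin n) // Nonempty (H.induce s ≃g F)} := by
  obtain ⟨σ, hσ⟩ := hGH
  have hcard : m < Nat.card (Fin n) := by simpa using hmn
  have range_iff (v : Fin n) (s : Set (Fin n)) :
      s ⊆ Set.range (Subtype.val : {x | x ≠ v} → Fin n) ↔ v ∉ s := by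
    rw [Subtype.range_coe]
    exact ⟨fun h hv => h hv rfl, fun hv x hx hxv => hv (hxv ▸ hx)⟩
  have ncard_eq {s : Set (Fin n)} {K : SimpleGraph s} : Nonempty (K ≃g F) → s.ncard = m :=
    fun ⟨f⟩ => by rw [← Nat.card_coe_set_eq, Nat.card_congr f.toEquiv, Nat.card_fin]
  let ι (K : SimpleGraph (Fin n)) (v : Fin n) : K.induce {x | x ≠ v} ↪g K :=
    SimpleGraph.Embedding.induce _
  have range_ι (K : SimpleGraph (Fin n)) (v : Fin n) (s : Set (Fin n)) :
      s ⊆ Set.range (ι K v) ↔ v ∉ s := range_iff v s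
  have range_comp (v : Fin n) (f : G.induce {x | x ≠ v} ≃g H.induce {y | y ≠ σ v})
      (s : Set (Fin n)) : s ⊆ Set.range ((ι H (σ v)).comp f.toEmbedding) ↔ σ v ∉ s := by
    rw [← range_ι H (σ v), ← f.surjective.range_comp (ι H (σ v))]
    rfl
  constructor
  · refine card_eq_of_card_avoiding_eq hcard (fun K => K.verts) (fun K => K.verts)
      (fun _ => ncard_eq) (fun _ => ncard_eq) σ fun v => ?_
    obtain ⟨f⟩ := hσ v
    simp_rw [← range_ι G v, ← range_comp v f]
    rw [← SimpleGraph.card_subgraph_iso_eq_card_range,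
      ← SimpleGraph.card_subgraph_iso_eq_card_range]
  · refine card_eq_of_card_avoiding_eq hcard id id
      (fun _ => ncard_eq) (fun _ => ncard_eq) σ fun v => ?_
    obtain ⟨f⟩ := hσ v
    simp_rw [id_eq, ← range_ι G v, ← range_comp v f]
    rw [← SimpleGraph.card_induce_iso_eq_card_range,
      ← SimpleGraph.card_induce_iso_eq_card_range]
end

section
/- Let G and H be hypomorphic simple graphs on n vertices, let v be a vertex of G and w a vertex of H with G − v isomorphic to H − w, and let F be a simple graph with 1 ≤ |V(F)| < n. Then the number of subgraphs of G isomorphic to F whose vertex set contains v equals the number of subgraphs of H isomorphic to F whose vertex set contains w (where a subgraph of G is a subset W of vertices together with a subset of the edges of G joining vertices of W); likewise the number of vertex subsets W containing v with G[W] isomorphic to F equals the number of vertex subsets containing w in H inducing a subgraph isomorphic to F. -/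
section Counting

variable {V α β : Type*} [Finite α]

/-- Double counting of the pairs formed by a member of a family of `m`-sets and a point
outside it. -/
lemma sum_card_notMem_eq [Fintype V] {m : ℕ} {P : α → Prop} {S : α → Set V}
    (hS : ∀ a, P a → (S a).ncard = m) :
    ∑ u, Nat.card {a // u ∉ S a ∧ P a} = Nat.card {a // P a} * (Nat.card V - m) := by
  have e : (Σ u, {a // u ∉ S a ∧ P a}) ≃ Σ a : {a // P a}, ((S a)ᶜ : Set V) :=
    { toFun := fun x => ⟨⟨x.2.1, x.2.2.2⟩, ⟨x.1, x.2.2.1⟩⟩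
      invFun := fun y => ⟨y.2.1, ⟨y.1.1, y.2.2, y.1.2⟩⟩
      left_inv := fun _ => rfl
      right_inv := fun _ => rfl }
  have := Fintype.ofFinite {a // P a}
  rw [← Nat.card_sigma, Nat.card_congr e, Nat.card_sigma,
    Finset.sum_congr rfl (g := fun _ => Nat.card V - m), Finset.sum_const, smul_eq_mul,
    Finset.card_univ, Nat.card_eq_fintype_card (α := {a // P a})]
  intro a _
  rw [Nat.card_coe_set_eq, Set.ncard_compl, hS a a.2]

lemma card_mem_add_card_notMem (P : α → Prop) (S : α → Set V) (v : V) :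
    Nat.card {a // v ∈ S a ∧ P a} + Nat.card {a // v ∉ S a ∧ P a} = Nat.card {a // P a} := by
  classical
  rw [← Nat.card_sum]
  exact Nat.card_congr <| (Equiv.sumCongr
    ((Equiv.subtypeEquivRight fun _ => and_comm).trans
      (Equiv.subtypeSubtypeEquivSubtypeInter P _).symm)
    ((Equiv.subtypeEquivRight fun _ => and_comm).trans
      (Equiv.subtypeSubtypeEquivSubtypeInter P _).symm)).trans
    (Equiv.sumCompl fun a : {a // P a} => v ∈ S a)

/-- If two families of `m`-sets, with `m < |V|`, have equally many members avoiding `u` and `σ u`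
for every `u`, and equally many members avoiding `v` and `w`, then they have equally many
members through `v` and `w`. -/
lemma card_mem_eq_of_card_notMem_eq [Finite V] [Finite β] {m : ℕ} (hm : m < Nat.card V)
    {P : α → Prop} {S : α → Set V} {Q : β → Prop} {T : β → Set V}
    (hS : ∀ a, P a → (S a).ncard = m) (hT : ∀ b, Q b → (T b).ncard = m) (σ : V ≃ V)
    (hσ : ∀ u, Nat.card {a // u ∉ S a ∧ P a} = Nat.card {b // σ u ∉ T b ∧ Q b}) {v w : V}
    (hvw : Nat.card {a // v ∉ S a ∧ P a} = Nat.card {b // w ∉ T b ∧ Q b}) :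
    Nat.card {a // v ∈ S a ∧ P a} = Nat.card {b // w ∈ T b ∧ Q b} := by
  have := Fintype.ofFinite V
  have htotal : Nat.card {a // P a} = Nat.card {b // Q b} := by
    refine Nat.eq_of_mul_eq_mul_right (Nat.sub_pos_of_lt hm) ?_
    rw [← sum_card_notMem_eq hS, ← sum_card_notMem_eq hT, Finset.sum_congr rfl fun u _ => hσ u]
    exact Equiv.sum_comp σ fun u => Nat.card {b // u ∉ T b ∧ Q b}
  have hv := card_mem_add_card_notMem P S v
  have hw := card_mem_add_card_notMem Q T w
  lia

end Counting

namespace SimpleGraph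

variable {U V W X : Type*} {A : SimpleGraph U} {G : SimpleGraph V}

lemma Subgraph.map_injective_of_embedding (f : A ↪g G) :
    Function.Injective (Subgraph.map f.toHom) := by
  intro K L h
  ext x y
  · have := congrArg (f x ∈ ·.verts) h
    simpa using this
  · have := congrArg (·.Adj (f x) (f y)) h
    simpa [Relation.map_apply_apply f.injective f.injective] using this

lemma Subgraph.map_comap_of_verts_subset_range (f : A ↪g G) {K : G.Subgraph}
    (hK : K.verts ⊆ Set.range f) : (K.comap f.toHom).map f.toHom = K := by
  ext x y
  · constructor
    · rintro ⟨u, hu, rfl⟩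
      exact hu
    · intro hx
      obtain ⟨u, rfl⟩ := hK hx
      exact ⟨u, hx, rfl⟩
  · constructor
    · rintro ⟨u, u', hu, rfl, rfl⟩
      exact hu.2
    · intro h
      obtain ⟨u, rfl⟩ := hK (K.edge_vert h)
      obtain ⟨u', rfl⟩ := hK (K.edge_vert h.symm)
      exact ⟨u, u', ⟨f.map_adj_iff.1 (K.adj_sub h), h⟩, rfl, rfl⟩

/-- Copies of `F` in `A` correspond to the copies of `F` in `G` that lie in the range of an
embedding of `A` in `G`. -/
lemma card_subgraph_iso_of_embedding (f : A ↪g G) (F : SimpleGraph X) :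
    Nat.card {K : A.Subgraph // Nonempty (K.coe ≃g F)} =
      Nat.card {K : G.Subgraph // K.verts ⊆ Set.range f ∧ Nonempty (K.coe ≃g F)} := by
  have hiso (K : A.Subgraph) : Nonempty (K.coe ≃g (K.map f.toHom).coe) :=
    ⟨f.toCopy.isoSubgraphMap K⟩
  refine Nat.card_congr (Equiv.ofBijective (fun K => ⟨K.1.map f.toHom, ?_, ?_⟩) ⟨?_, ?_⟩)
  · exact Set.image_subset_range _ _
  · exact K.2.map fun e => (hiso K.1).some.symm.trans e
  · intro K L h
    exact Subtype.ext (Subgraph.map_injective_of_embedding f (congrArg Subtype.val h))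
  · rintro ⟨K, hK, ⟨e⟩⟩
    have hmap := Subgraph.map_comap_of_verts_subset_range f hK
    refine ⟨⟨K.comap f.toHom, ?_⟩, Subtype.ext hmap⟩
    have := hiso (K.comap f.toHom)
    rw [hmap] at this
    exact this.map fun e' => e'.trans e

/-- Induced copies of `F` in `A` correspond to the induced copies of `F` in `G` that lie in the
range of an embedding of `A` in `G`. -/
lemma card_induce_iso_of_embedding (f : A ↪g G) (F : SimpleGraph X) :
    Nat.card {s : Set U // Nonempty (A.induce s ≃g F)} =
      Nat.card {s : Set V // s ⊆ Set.range f ∧ Nonempty (G.induce s ≃g F)} := by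
  have hiso (s : Set U) : Nonempty (A.induce s ≃g G.induce (f '' s)) :=
    ⟨⟨Equiv.Set.image f s f.injective, f.map_adj_iff⟩⟩
  refine Nat.card_congr (Equiv.ofBijective (fun s => ⟨f '' s.1, ?_, ?_⟩) ⟨?_, ?_⟩)
  · exact Set.image_subset_range _ _
  · exact s.2.map fun e => (hiso s.1).some.symm.trans e
  · intro s t h
    exact Subtype.ext (f.injective.image_injective (congrArg Subtype.val h))
  · rintro ⟨s, hs, ⟨e⟩⟩
    obtain ⟨t, rfl⟩ := Set.subset_range_iff_exists_image_eq.1 hs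
    exact ⟨⟨t, (hiso t).map fun e' => e'.trans e⟩, rfl⟩

section Cards

variable {H : SimpleGraph W} {v : V} {w : W}

lemma range_induce_comp_iso (e : A ≃g H.induce {y | y ≠ w}) :
    Set.range ((Embedding.induce (G := H) {y | y ≠ w}).comp e.toEmbedding) = {w}ᶜ :=
  (e.surjective.range_comp _).trans Subtype.range_coe

lemma card_subgraph_iso_notMem_eq (F : SimpleGraph X)
    (e : G.induce {x | x ≠ v} ≃g H.induce {y | y ≠ w}) :
    Nat.card {K : G.Subgraph // v ∉ K.verts ∧ Nonempty (K.coe ≃g F)} =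
      Nat.card {K : H.Subgraph // w ∉ K.verts ∧ Nonempty (K.coe ≃g F)} := by
  have hG := card_subgraph_iso_of_embedding (Embedding.induce (G := G) {x | x ≠ v}) F
  have hH := card_subgraph_iso_of_embedding
    ((Embedding.induce (G := H) {y | y ≠ w}).comp e.toEmbedding) F
  have hrange : Set.range (Embedding.induce (G := G) {x | x ≠ v}) = {v}ᶜ := Subtype.range_coe
  simp only [hrange, range_induce_comp_iso, Set.subset_compl_singleton_iff] at hG hH
  exact hG.symm.trans hH

lemma card_induce_iso_notMem_eq (F : SimpleGraph X)
    (e : G.induce {x | x ≠ v} ≃g H.induce {y | y ≠ w}) :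
    Nat.card {s : Set V // v ∉ s ∧ Nonempty (G.induce s ≃g F)} =
      Nat.card {s : Set W // w ∉ s ∧ Nonempty (H.induce s ≃g F)} := by
  have hG := card_induce_iso_of_embedding (Embedding.induce (G := G) {x | x ≠ v}) F
  have hH := card_induce_iso_of_embedding
    ((Embedding.induce (G := H) {y | y ≠ w}).comp e.toEmbedding) F
  have hrange : Set.range (Embedding.induce (G := G) {x | x ≠ v}) = {v}ᶜ := Subtype.range_coe
  simp only [hrange, range_induce_comp_iso, Set.subset_compl_singleton_iff] at hG hH
  exact hG.symm.trans hH

end Cards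

end SimpleGraph

/-- Kelly's lemma, vertex form: if `G` and `H` are hypomorphic graphs on `n` vertices,
`v`, `w` are vertices with `G − v ≅ H − w`, and `F` is a graph with `1 ≤ m < n` vertices,
then the number of subgraphs of `G` isomorphic to `F` containing `v` equals the number of
subgraphs of `H` isomorphic to `F` containing `w`; likewise for induced subgraphs. -/
theorem stmt1 {n m : ℕ} (hm : 1 ≤ m) (hmn : m < n)
    (G H : SimpleGraph (Fin n)) (F : SimpleGraph (Fin m))
    (hGH : GHypomorphic G H) (v w : Fin n)
    (hvw : Nonempty (G.induce ({x | x ≠ v} : Set (Fin n)) ≃g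
                     H.induce ({y | y ≠ w} : Set (Fin n)))) :
    Nat.card {K : G.Subgraph // v ∈ K.verts ∧ Nonempty (K.coe ≃g F)} =
      Nat.card {K : H.Subgraph // w ∈ K.verts ∧ Nonempty (K.coe ≃g F)} ∧
    Nat.card {s : Set (Fin n) // v ∈ s ∧ Nonempty (G.induce s ≃g F)} =
      Nat.card {s : Set (Fin n) // w ∈ s ∧ Nonempty (H.induce s ≃g F)} := by
  obtain ⟨σ, hσ⟩ := hGH
  obtain ⟨e⟩ := hvw
  have hcard {s : Set (Fin n)} {A : SimpleGraph s} (h : Nonempty (A ≃g F)) : s.ncard = m := by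
    rw [← Nat.card_coe_set_eq, Nat.card_congr h.some.toEquiv, Nat.card_fin]
  have hmn' : m < Nat.card (Fin n) := by rwa [Nat.card_fin]
  constructor
  · exact card_mem_eq_of_card_notMem_eq hmn' (S := SimpleGraph.Subgraph.verts)
      (T := SimpleGraph.Subgraph.verts) (fun _ => hcard) (fun _ => hcard) σ
      (fun u => SimpleGraph.card_subgraph_iso_notMem_eq F (hσ u).some)
      (SimpleGraph.card_subgraph_iso_notMem_eq F e)
  · exact card_mem_eq_of_card_notMem_eq hmn' (S := id) (T := id)
      (fun _ => hcard) (fun _ => hcard) σ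
      (fun u => SimpleGraph.card_induce_iso_notMem_eq F (hσ u).some)
      (SimpleGraph.card_induce_iso_notMem_eq F e)
end

section
/- Let D and E be hypomorphic digraphs on n vertices and let F be a digraph with 1 ≤ |V(F)| < n. Then the number of vertex subsets W of D such that the induced subdigraph D[W] is isomorphic to F equals the number of vertex subsets of E inducing a subdigraph isomorphic to F. -/
/-- An isomorphism between two digraphs (given as arc relations) is a vertex bijection
preserving the arc relation in both directions. -/
def DIso {V W : Type*} (D : V → V → Prop) (E : W → W → Prop) : Prop :=
  ∃ f : V ≃ W, ∀ x y, D x y ↔ E (f x) (f y)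

/-- The card of a digraph `D` obtained by deleting the vertex `v`. -/
def dCard {V : Type*} (D : V → V → Prop) (v : V) :
    {x : V // x ≠ v} → {x : V // x ≠ v} → Prop :=
  fun x y => D x.1 y.1

/-- Two digraphs on `Fin n` are hypomorphic if some bijection of their vertex sets
matches each card of one with an isomorphic card of the other. -/
def DHypomorphic {n : ℕ} (D E : Fin n → Fin n → Prop) : Prop :=
  ∃ σ : Fin n ≃ Fin n, ∀ v, DIso (dCard D v) (dCard E (σ v))

/-- First degree: the number of out-neighbors of `v`. -/
noncomputable def aDeg {V : Type*} (D : V → V → Prop) (v : V) : ℕ :=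
  Nat.card {w : V // D v w ∧ ¬ D w v}

/-- Second degree: the number of in-neighbors of `v`. -/
noncomputable def bDeg {V : Type*} (D : V → V → Prop) (v : V) : ℕ :=
  Nat.card {w : V // D w v ∧ ¬ D v w}

/-- Third degree: the number of strong neighbors of `v`. -/
noncomputable def cDeg {V : Type*} (D : V → V → Prop) (v : V) : ℕ :=
  Nat.card {w : V // D v w ∧ D w v}

/-- The degree triple of a vertex. -/
noncomputable def degTriple {V : Type*} (D : V → V → Prop) (v : V) : ℕ × ℕ × ℕ :=
  (aDeg D v, bDeg D v, cDeg D v)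

/-- Two digraphs on `Fin n` are da-hypomorphic if some bijection of their vertex sets
matches each card of one with an isomorphic card of the other, the deleted vertices
having the same degree triple. -/
def DaHypomorphic {n : ℕ} (D E : Fin n → Fin n → Prop) : Prop :=
  ∃ σ : Fin n ≃ Fin n, ∀ v, DIso (dCard D v) (dCard E (σ v)) ∧
    degTriple D v = degTriple E (σ v)

/-- The subdigraph of `D` induced on a vertex subset `s`. -/
def dInduce {V : Type*} (D : V → V → Prop) (s : Set V) : s → s → Prop :=
  fun x y => D x.1 y.1

theorem DIso.symm {V W : Type*} {D : V → V → Prop} {E : W → W → Prop} (h : DIso D E) :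
    DIso E D := by
  obtain ⟨f, hf⟩ := h
  exact ⟨f.symm, fun x y => by simp [hf]⟩

theorem DIso.trans {U V W : Type*} {C : U → U → Prop} {D : V → V → Prop} {E : W → W → Prop}
    (h : DIso C D) (h' : DIso D E) : DIso C E := by
  obtain ⟨f, hf⟩ := h
  obtain ⟨g, hg⟩ := h'
  exact ⟨f.trans g, fun x y => (hf x y).trans (hg _ _)⟩

/-- An embedding of digraphs carries an induced subdigraph to an isomorphic one. -/
theorem dIso_dInduce_image {V W : Type*} {D : V → V → Prop} {E : W → W → Prop} {g : V → W}
    (hg : Function.Injective g) (h : ∀ x y, D x y ↔ E (g x) (g y)) (t : Set V) :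
    DIso (dInduce D t) (dInduce E (g '' t)) :=
  ⟨Equiv.Set.image g t hg, fun x y => h x y⟩

/-- The copies of `F` in `D` correspond to the copies of `F` in `E` inside the range of an
embedding of `D` into `E`. -/
theorem card_dInduce_subset_range {U V W : Type*} {D : V → V → Prop} {E : W → W → Prop}
    (F : U → U → Prop) {g : V → W} (hg : Function.Injective g)
    (h : ∀ x y, D x y ↔ E (g x) (g y)) :
    Nat.card {t : Set V // DIso (dInduce D t) F} =
      Nat.card {s : Set W // s ⊆ Set.range g ∧ DIso (dInduce E s) F} := by
  refine Nat.card_congr (Equiv.ofBijective (fun t => ⟨g '' t.1, Set.image_subset_range _ _,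
    (dIso_dInduce_image hg h t.1).symm.trans t.2⟩) ⟨fun t t' htt' => ?_, ?_⟩)
  · exact Subtype.ext (hg.image_injective (congrArg Subtype.val htt'))
  · rintro ⟨s, hs, hF⟩
    obtain ⟨t, rfl⟩ := Set.subset_range_iff_exists_image_eq.1 hs
    exact ⟨⟨t, (dIso_dInduce_image hg h t).trans hF⟩, rfl⟩

/-- The copies of `F` avoiding `v` are counted by the card at `v`. -/
theorem card_dInduce_notMem {U V : Type*} (D : V → V → Prop) (F : U → U → Prop) (v : V) :
    Nat.card {s : Set V // v ∉ s ∧ DIso (dInduce D s) F} =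
      Nat.card {t : Set {x : V // x ≠ v} // DIso (dInduce (dCard D v) t) F} := by
  rw [card_dInduce_subset_range (D := dCard D v) (E := D) F Subtype.val_injective fun _ _ => Iff.rfl]
  simp [Set.subset_def, imp_not_comm]

/-- Isomorphic digraphs have the same number of copies of `F`. -/
theorem DIso.card_dInduce_eq {U V W : Type*} {D : V → V → Prop} {E : W → W → Prop}
    (F : U → U → Prop) (h : DIso D E) :
    Nat.card {s : Set V // DIso (dInduce D s) F} =
      Nat.card {s : Set W // DIso (dInduce E s) F} := by
  obtain ⟨f, hf⟩ := h
  rw [card_dInduce_subset_range F f.injective hf]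
  simp

/-- Each copy of `F` in `D` is avoided by exactly `n - m` vertices. -/
theorem sum_card_dInduce_notMem {n m : ℕ} (D : Fin n → Fin n → Prop) (F : Fin m → Fin m → Prop) :
    ∑ v, Nat.card {s : Set (Fin n) // v ∉ s ∧ DIso (dInduce D s) F} =
      Nat.card {s : Set (Fin n) // DIso (dInduce D s) F} * (n - m) := by
  classical
  have hcard (s : Set (Fin n)) (hs : DIso (dInduce D s) F) :
      (Finset.univ.filter fun v => v ∉ s).card = n - m := by
    obtain ⟨f, -⟩ := hs
    have hm : s.toFinset.card = m := by
      rw [Set.toFinset_card, Fintype.card_congr f, Fintype.card_fin]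
    have hc : (Finset.univ.filter fun v => v ∉ s) = s.toFinsetᶜ := by
      ext v
      simp
    rw [hc, Finset.card_compl, hm, Fintype.card_fin]
  simp only [Nat.card_eq_fintype_card, Fintype.card_subtype]
  have key := Finset.sum_card_bipartiteAbove_eq_sum_card_bipartiteBelow
    (s := (Finset.univ : Finset (Fin n)))
    (t := Finset.univ.filter fun s : Set (Fin n) => DIso (dInduce D s) F)
    (fun v s => v ∉ s)
  simp only [Finset.bipartiteAbove, Finset.bipartiteBelow, Finset.filter_filter] at key
  simp only [and_comm (a := _ ∉ _), key]
  exact Finset.sum_const_nat fun s hs => hcard s (Finset.mem_filter.1 hs).2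

/-- Kelly's lemma for digraphs: if `D` and `E` are hypomorphic digraphs on `n` vertices
and `F` is a digraph with `1 ≤ m < n` vertices, then `D` and `E` have the same number of
vertex subsets inducing a subdigraph isomorphic to `F`. -/
theorem stmt2 {n m : ℕ} (hm : 1 ≤ m) (hmn : m < n)
    (D E : Fin n → Fin n → Prop) (F : Fin m → Fin m → Prop)
    (hD : Irreflexive D) (hE : Irreflexive E) (hF : Irreflexive F)
    (hDE : DHypomorphic D E) :
    Nat.card {s : Set (Fin n) // DIso (dInduce D s) F} =
      Nat.card {s : Set (Fin n) // DIso (dInduce E s) F} := by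
  obtain ⟨σ, hσ⟩ := hDE
  refine Nat.eq_of_mul_eq_mul_right (Nat.sub_pos_of_lt hmn) ?_
  rw [← sum_card_dInduce_notMem, ← sum_card_dInduce_notMem,
    ← Equiv.sum_comp σ fun v => Nat.card {s : Set (Fin n) // v ∉ s ∧ DIso (dInduce E s) F}]
  refine Finset.sum_congr rfl fun v _ => ?_
  rw [card_dInduce_notMem, card_dInduce_notMem]
  exact (hσ v).card_dInduce_eq F
end

section
/- If D and E are hypomorphic digraphs on n ≥ 3 vertices, then D and E have the same number of unpaired arcs and the same number of biarcs. -/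
/-- The number of unpaired arcs of a digraph on `Fin n`. -/
noncomputable def unpairedArcCount {n : ℕ} (D : Fin n → Fin n → Prop) : ℕ :=
  Nat.card {p : Fin n × Fin n // D p.1 p.2 ∧ ¬ D p.2 p.1}

/-- The number of biarcs (symmetric pairs of arcs) of a digraph on `Fin n`. -/
noncomputable def biarcCount {n : ℕ} (D : Fin n → Fin n → Prop) : ℕ :=
  Nat.card {p : Fin n × Fin n // p.1 < p.2 ∧ D p.1 p.2 ∧ D p.2 p.1}

/-- The number of arcs of a digraph. -/
noncomputable def arcCount {V : Type*} (R : V → V → Prop) : ℕ :=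
  Nat.card {p : V × V // R p.1 p.2}

theorem DIso.arcCount_eq {V W : Type*} {R : V → V → Prop} {S : W → W → Prop}
    (h : DIso R S) : arcCount R = arcCount S := by
  obtain ⟨f, hf⟩ := h
  exact Nat.card_congr ((f.prodCongr f).subtypeEquiv fun p => hf p.1 p.2)

/-- Deleting each vertex in turn counts every arc once for each vertex off the arc. -/
theorem sum_arcCount_dCard {V : Type*} [Fintype V] {R : V → V → Prop} (hR : Irreflexive R) :
    ∑ v, arcCount (dCard R v) = arcCount R * (Fintype.card V - 2) := by
  classical
  have hcard (v : V) : arcCount (dCard R v) =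
      (({p | R p.1 p.2} : Finset (V × V)).filter fun p => p.1 ≠ v ∧ p.2 ≠ v).card := by
    rw [← Fintype.card_coe, ← Nat.card_eq_fintype_card]
    refine Nat.card_congr
      { toFun := fun p => ⟨(p.1.1.1, p.1.2.1), ?_⟩
        invFun := fun p => ⟨(⟨p.1.1, ?_⟩, ⟨p.1.2, ?_⟩), ?_⟩
        left_inv := fun _ => rfl
        right_inv := fun _ => rfl }
    · simpa using ⟨p.2, p.1.1.2, p.1.2.2⟩
    · exact (Finset.mem_filter.1 p.2).2.1
    · exact (Finset.mem_filter.1 p.2).2.2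
    · exact (Finset.mem_filter.1 (Finset.mem_filter.1 p.2).1).2
  have harc : arcCount R = ({p | R p.1 p.2} : Finset (V × V)).card := by
    rw [arcCount, Nat.card_eq_fintype_card, Fintype.card_subtype]
  simp_rw [hcard, harc, Finset.card_filter _ (Finset.filter _ _)]
  rw [Finset.sum_comm, ← smul_eq_mul, ← Finset.sum_const]
  refine Finset.sum_congr rfl fun p hp => ?_
  have hne : p.1 ≠ p.2 := fun h => hR p.1 (by simpa [← h] using hp)
  rw [← Finset.card_filter, ← Finset.card_pair hne, ← Finset.card_compl]
  congr 1
  ext v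
  simp [eq_comm]

/-- The number of arcs is determined by the cards. -/
theorem arcCount_eq_of_dCard {V W : Type*} [Fintype V] [Fintype W] {R : V → V → Prop}
    {S : W → W → Prop} (hR : Irreflexive R) (hS : Irreflexive S) (hV : 3 ≤ Fintype.card V)
    (σ : V ≃ W) (h : ∀ v, DIso (dCard R v) (dCard S (σ v))) : arcCount R = arcCount S := by
  refine Nat.eq_of_mul_eq_mul_right (by omega : 0 < Fintype.card V - 2) ?_
  rw [← sum_arcCount_dCard hR, Fintype.card_congr σ, ← sum_arcCount_dCard hS,
    ← Equiv.sum_comp σ]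
  exact Finset.sum_congr rfl fun v _ => (h v).arcCount_eq

/-- Every biarc consists of two arcs. -/
theorem two_mul_biarcCount {n : ℕ} {D : Fin n → Fin n → Prop} (hD : Irreflexive D) :
    2 * biarcCount D = arcCount fun x y => D x y ∧ D y x := by
  classical
  have hswap : biarcCount D =
      Nat.card {p : Fin n × Fin n // p.2 < p.1 ∧ D p.1 p.2 ∧ D p.2 p.1} :=
    Nat.card_congr ((Equiv.prodComm _ _).subtypeEquiv fun p => by simp [and_comm])
  rw [two_mul]
  nth_rewrite 2 [hswap]
  simp only [biarcCount, arcCount, Nat.card_eq_fintype_card]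
  rw [← Fintype.card_subtype_or_disjoint]
  · refine Fintype.card_congr (Equiv.subtypeEquivRight fun p => ?_)
    have hne (h : D p.1 p.2) : p.1 ≠ p.2 := fun he => hD p.1 (by rwa [← he] at h)
    grind
  · rw [Pi.disjoint_iff]
    intro p
    rw [Prop.disjoint_iff]
    grind

/-- If `D` and `E` are hypomorphic digraphs on `n ≥ 3` vertices, then they have the
same number of unpaired arcs and the same number of biarcs. -/
theorem stmt3 {n : ℕ} (hn : 3 ≤ n) (D E : Fin n → Fin n → Prop)
    (hD : Irreflexive D) (hE : Irreflexive E) (hDE : DHypomorphic D E) :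
    unpairedArcCount D = unpairedArcCount E ∧ biarcCount D = biarcCount E := by
  obtain ⟨σ, h⟩ := hDE
  have hcard : 3 ≤ Fintype.card (Fin n) := by simpa using hn
  constructor
  · refine arcCount_eq_of_dCard (R := fun x y => D x y ∧ ¬ D y x)
      (S := fun x y => E x y ∧ ¬ E y x) (fun x hx => hx.2 hx.1) (fun x hx => hx.2 hx.1)
      hcard σ fun v => ?_
    obtain ⟨f, hf⟩ := h v
    exact ⟨f, fun x y => and_congr (hf x y) (not_congr (hf y x))⟩
  · refine Nat.eq_of_mul_eq_mul_left two_pos ?_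
    rw [two_mul_biarcCount hD, two_mul_biarcCount hE]
    refine arcCount_eq_of_dCard (fun x hx => hD x hx.1) (fun x hx => hE x hx.1)
      hcard σ fun v => ?_
    obtain ⟨f, hf⟩ := h v
    exact ⟨f, fun x y => and_congr (hf x y) (hf y x)⟩
end

section
/- Let D and E be hypomorphic digraphs on n ≥ 3 vertices, let v be a vertex of D and w a vertex of E with D − v isomorphic to E − w. Then a_D(v) + b_D(v) = a_E(w) + b_E(w) and c_D(v) = c_E(w) (that is, v and w have the same split degree). If moreover a_D(v) + c_D(v) = a_E(w) + c_E(w) and b_D(v) + c_D(v) = b_E(w) + c_E(w) (the same degree pair), then dt_D(v) = dt_E(w). -/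
/-- The total weight of the card of `f` at `v`. -/
def cardWeight {V : Type*} [Fintype V] [DecidableEq V] (f : V → V → ℤ) (v : V) : ℤ :=
  ∑ x : {x : V // x ≠ v}, ∑ y : {x : V // x ≠ v}, f x y

theorem cardWeight_add_two_mul {V : Type*} [Fintype V] [DecidableEq V] (f : V → V → ℤ)
    (hsymm : ∀ x y, f x y = f y x) (hdiag : ∀ x, f x x = 0) (v : V) :
    cardWeight f v + 2 * ∑ y, f v y = ∑ x, ∑ y, f x y := by
  have hrow : ∀ x, ∑ y, f x y = f x v + ∑ y : {y : V // y ≠ v}, f x y := fun x =>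
    Fintype.sum_eq_add_sum_subtype_ne _ v
  have hcol : ∑ x : {x : V // x ≠ v}, f x v = ∑ y, f v y := by
    rw [hrow v, hdiag, zero_add]
    exact Finset.sum_congr rfl fun x _ => hsymm _ _
  rw [Fintype.sum_eq_add_sum_subtype_ne (fun x => ∑ y, f x y) v]
  simp only [fun x : {x : V // x ≠ v} => hrow x, Finset.sum_add_distrib, hcol, cardWeight]
  ring

/-- Kelly's counting argument: for symmetric weights, the weights of all cards determine
the total weight. -/
theorem sum_cardWeight {V : Type*} [Fintype V] [DecidableEq V] (f : V → V → ℤ)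
    (hsymm : ∀ x y, f x y = f y x) (hdiag : ∀ x, f x x = 0) :
    ∑ v, cardWeight f v = ((Fintype.card V : ℤ) - 2) * ∑ x, ∑ y, f x y := by
  have h : ∑ v, (cardWeight f v + 2 * ∑ y, f v y) = ∑ _v : V, ∑ x, ∑ y, f x y :=
    Finset.sum_congr rfl fun v _ => cardWeight_add_two_mul f hsymm hdiag v
  rw [Finset.sum_add_distrib, ← Finset.mul_sum, Finset.sum_const, Finset.card_univ,
    nsmul_eq_mul] at h
  linarith

theorem sum_row_eq_of_cardWeight_eq {V : Type*} [Fintype V] [DecidableEq V]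
    (hV : 3 ≤ Fintype.card V) (f g : V → V → ℤ)
    (hf : ∀ x y, f x y = f y x) (hf₀ : ∀ x, f x x = 0)
    (hg : ∀ x y, g x y = g y x) (hg₀ : ∀ x, g x x = 0)
    (σ : V ≃ V) (hσ : ∀ v, cardWeight f v = cardWeight g (σ v))
    {v w : V} (hvw : cardWeight f v = cardWeight g w) :
    ∑ y, f v y = ∑ y, g w y := by
  have hsum : ∑ v, cardWeight f v = ∑ v, cardWeight g v := by
    rw [← Equiv.sum_comp σ (cardWeight g)]
    exact Finset.sum_congr rfl fun v _ => hσ v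
  rw [sum_cardWeight f hf hf₀, sum_cardWeight g hg hg₀] at hsum
  have hpos : (Fintype.card V : ℤ) - 2 ≠ 0 := by omega
  have htotal := mul_left_cancel₀ hpos hsum
  have h₁ := cardWeight_add_two_mul f hf hf₀ v
  have h₂ := cardWeight_add_two_mul g hg hg₀ w
  linarith

/-- The weight of a pair of vertices of `D`, as a function `φ` of the truth values of the
two possible arcs between them. -/
def arcWeight {V : Type*} (φ : Prop → Prop → ℤ) (D : V → V → Prop) (x y : V) : ℤ :=
  φ (D x y) (D y x)

theorem DIso.cardWeight_eq {V : Type*} [Fintype V] [DecidableEq V] {D E : V → V → Prop}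
    {v w : V} (h : DIso (dCard D v) (dCard E w)) (φ : Prop → Prop → ℤ) :
    cardWeight (arcWeight φ D) v = cardWeight (arcWeight φ E) w := by
  obtain ⟨e, he⟩ := h
  have he' : ∀ x y : {x : V // x ≠ v}, D x y = E (e x) (e y) := fun x y => propext (he x y)
  unfold cardWeight arcWeight
  rw [← Equiv.sum_comp e]
  refine Finset.sum_congr rfl fun x _ => ?_
  rw [← Equiv.sum_comp e]
  exact Finset.sum_congr rfl fun y _ => by rw [he', he']

theorem sum_arcWeight_eq_of_hypomorphic {n : ℕ} (hn : 3 ≤ n) {D E : Fin n → Fin n → Prop}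
    (hD : ∀ x, ¬ D x x) (hE : ∀ x, ¬ E x x) (hDE : DHypomorphic D E)
    {v w : Fin n} (hcard : DIso (dCard D v) (dCard E w)) (φ : Prop → Prop → ℤ)
    (hφ : ∀ p q, φ p q = φ q p) (hφ₀ : φ False False = 0) :
    ∑ y, arcWeight φ D v y = ∑ y, arcWeight φ E w y := by
  obtain ⟨σ, hσ⟩ := hDE
  exact sum_row_eq_of_cardWeight_eq (by simpa using hn) _ _
    (fun _ _ => hφ _ _) (fun x => by simp [hD x, hφ₀])
    (fun _ _ => hφ _ _) (fun x => by simp [hE x, hφ₀])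
    σ (fun u => (hσ u).cardWeight_eq φ) (hcard.cardWeight_eq φ)

open Classical in
theorem cDeg_eq_sum_arcWeight {V : Type*} [Fintype V] (D : V → V → Prop) (v : V) :
    (cDeg D v : ℤ) = ∑ y, arcWeight (fun p q => if p ∧ q then 1 else 0) D v y := by
  simp [cDeg, arcWeight, Nat.card_eq_fintype_card, Fintype.card_subtype]

open Classical in
theorem aDeg_add_bDeg_eq_sum_arcWeight {V : Type*} [Fintype V] (D : V → V → Prop) (v : V) :
    ((aDeg D v + bDeg D v : ℕ) : ℤ) = ∑ y, arcWeight
      (fun p q => (if p ∧ ¬ q then 1 else 0) + (if q ∧ ¬ p then 1 else 0)) D v y := by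
  simp only [aDeg, bDeg, arcWeight, Nat.card_eq_fintype_card, Fintype.card_subtype,
    Finset.sum_add_distrib, Finset.sum_boole, Nat.cast_add]

/-- If `D` and `E` are hypomorphic digraphs on `n ≥ 3` vertices and `v`, `w` are vertices
with `D − v ≅ E − w`, then `v` and `w` have the same split degree; and if moreover they
have the same degree pair, then they have the same degree triple. -/
theorem stmt4 {n : ℕ} (hn : 3 ≤ n) (D E : Fin n → Fin n → Prop)
    (hD : Irreflexive D) (hE : Irreflexive E) (hDE : DHypomorphic D E)
    (v w : Fin n) (hcard : DIso (dCard D v) (dCard E w)) :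
    (aDeg D v + bDeg D v = aDeg E w + bDeg E w ∧ cDeg D v = cDeg E w) ∧
    ((aDeg D v + cDeg D v = aDeg E w + cDeg E w ∧
        bDeg D v + cDeg D v = bDeg E w + cDeg E w) →
      degTriple D v = degTriple E w) := by
  classical
  have hab : aDeg D v + bDeg D v = aDeg E w + bDeg E w := by
    have h := sum_arcWeight_eq_of_hypomorphic hn hD hE hDE hcard
      (fun p q => (if p ∧ ¬ q then 1 else 0) + (if q ∧ ¬ p then 1 else 0))
      (fun _ _ => add_comm _ _) (by simp)
    exact_mod_cast (aDeg_add_bDeg_eq_sum_arcWeight D v).trans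
      (h.trans (aDeg_add_bDeg_eq_sum_arcWeight E w).symm)
  have hc : cDeg D v = cDeg E w := by
    have h := sum_arcWeight_eq_of_hypomorphic hn hD hE hDE hcard
      (fun p q => if p ∧ q then 1 else 0) (fun _ _ => by simp only [and_comm]) (by simp)
    exact_mod_cast (cDeg_eq_sum_arcWeight D v).trans
      (h.trans (cDeg_eq_sum_arcWeight E w).symm)
  refine ⟨⟨hab, hc⟩, fun ⟨hac, hbc⟩ => ?_⟩
  have ha : aDeg D v = aDeg E w := by omega
  have hb : bDeg D v = bDeg E w := by omega
  simp only [degTriple, ha, hb, hc]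
end

section
/- Let G and H be hypomorphic simple graphs on n vertices, let m satisfy 3 ≤ m < n, and let v be a vertex of G and w a vertex of H with G − v isomorphic to H − w. Then the number of star subgraphs of G isomorphic to K_{1,m−1} in which v is an end vertex (a leaf of the star) equals the number of star subgraphs of H isomorphic to K_{1,m−1} in which w is a leaf; likewise the number of star subgraphs of G isomorphic to K_{1,m−1} with v as center equals the number of star subgraphs of H isomorphic to K_{1,m−1} with w as center. (Here a star subgraph of G is a subset of m vertices together with m−1 edges of G all incident to one of them, the center.) -/
/-- The number of star subgraphs of `G` isomorphic to `K_{1,m-1}`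
(a center together with `m - 1` leaves joined to it by edges of `G`)
in which `v` is a leaf. -/
noncomputable def starLeafCount {n : ℕ} (G : SimpleGraph (Fin n)) (m : ℕ) (v : Fin n) : ℕ :=
  Nat.card {p : Fin n × Finset (Fin n) //
    p.1 ∉ p.2 ∧ p.2.card = m - 1 ∧ (∀ x ∈ p.2, G.Adj p.1 x) ∧ v ∈ p.2}

/-- The number of star subgraphs of `G` isomorphic to `K_{1,m-1}` with `v` as center. -/
noncomputable def starCenterCount {n : ℕ} (G : SimpleGraph (Fin n)) (m : ℕ) (v : Fin n) : ℕ :=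
  Nat.card {p : Fin n × Finset (Fin n) //
    p.1 ∉ p.2 ∧ p.2.card = m - 1 ∧ (∀ x ∈ p.2, G.Adj p.1 x) ∧ p.1 = v}

open Finset Classical in
/-- The stars of `G` with `k` leaves, each given by its center and its set of leaves. -/
noncomputable def starFinset {V : Type*} [Fintype V] (G : SimpleGraph V) (k : ℕ) :
    Finset (V × Finset V) :=
  {p | p.1 ∉ p.2 ∧ #p.2 = k ∧ ∀ x ∈ p.2, G.Adj p.1 x}

section Stars

open Finset Classical

variable {V : Type*} [Fintype V] (G H : SimpleGraph V) (k : ℕ) (v w : V)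

lemma mem_starFinset {p : V × Finset V} :
    p ∈ starFinset G k ↔ p.1 ∉ p.2 ∧ #p.2 = k ∧ ∀ x ∈ p.2, G.Adj p.1 x := by
  simp [starFinset]

/-- The stars with `k` leaves are split by the role of a vertex `v`: either `v` is not
used, or it is a leaf, or it is the center. -/
lemma card_starFinset_eq_add :
    #(starFinset G k) = #{p ∈ starFinset G k | v ∉ insert p.1 p.2} +
      (#{p ∈ starFinset G k | v ∈ p.2} + #{p ∈ starFinset G k | p.1 = v}) := by
  rw [← card_union_of_disjoint, ← card_union_of_disjoint]
  · congr 1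
    ext p
    simp only [mem_union, mem_filter, mem_insert]
    grind
  · rw [disjoint_left]
    intro p
    simp only [mem_union, mem_filter, mem_insert]
    grind
  · rw [disjoint_left]
    intro p
    simp only [mem_filter, mem_starFinset]
    rintro ⟨⟨h, -⟩, hv⟩ ⟨-, rfl⟩
    exact h hv

/-- Double counting of the pairs of a star and a vertex outside of it. -/
lemma sum_card_starFinset_avoiding :
    ∑ v, #{p ∈ starFinset G k | v ∉ insert p.1 p.2} =
      #(starFinset G k) * (Fintype.card V - (k + 1)) := by
  rw [← sum_const_nat (s := starFinset G k)
    (f := fun p ↦ #{v ∈ (univ : Finset V) | v ∉ insert p.1 p.2})]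
  · exact sum_card_bipartiteAbove_eq_sum_card_bipartiteBelow
      (fun (v : V) (p : V × Finset V) ↦ v ∉ insert p.1 p.2)
  · intro p hp
    obtain ⟨h, hk, -⟩ := (mem_starFinset G k).1 hp
    rw [← compl_filter, card_compl, filter_univ_mem, card_insert_of_notMem h, hk]

lemma card_starFinset_center :
    #{p ∈ starFinset G k | p.1 = v} = (G.degree v).choose k := by
  rw [← G.card_neighborFinset_eq_degree, ← card_powersetCard]
  refine card_nbij' Prod.snd (fun s ↦ (v, s)) ?_ ?_ ?_ ?_
  · rintro ⟨c, s⟩ h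
    simp only [coe_filter, Set.mem_ofPred_eq, mem_starFinset] at h
    obtain ⟨⟨-, hk, hs⟩, rfl⟩ := h
    simp only [mem_coe, mem_powersetCard]
    exact ⟨fun x hx ↦ by simpa using hs x hx, hk⟩
  · intro s h
    simp only [mem_coe, mem_powersetCard] at h
    simp only [coe_filter, Set.mem_ofPred_eq, mem_starFinset]
    have hs : ∀ x ∈ s, G.Adj v x := fun x hx ↦ by simpa using h.1 hx
    exact ⟨⟨fun hv ↦ (hs v hv).ne rfl, h.2, hs⟩, trivial⟩
  · rintro ⟨c, s⟩ h
    simp only [coe_filter, Set.mem_ofPred_eq] at h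
    simp [h.2]
  · exact fun _ _ ↦ rfl

lemma card_starFinset_one_leaf :
    #{p ∈ starFinset G 1 | v ∈ p.2} = G.degree v := by
  rw [← G.card_neighborFinset_eq_degree]
  refine card_nbij' Prod.fst (fun c ↦ (c, {v})) ?_ ?_ ?_ ?_
  · rintro ⟨c, s⟩ h
    simp only [coe_filter, Set.mem_ofPred_eq, mem_starFinset] at h
    simpa using (h.1.2.2 v h.2).symm
  · intro c h
    have h : G.Adj v c := by simpa using h
    simp [mem_starFinset, h.symm, h.ne']
  · rintro ⟨c, s⟩ h
    simp only [coe_filter, Set.mem_ofPred_eq, mem_starFinset] at h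
    obtain ⟨x, rfl⟩ := card_eq_one.1 h.1.2.1
    simp [mem_singleton.1 h.2]
  · exact fun _ _ ↦ rfl

variable {G H v w}

/-- The number of stars avoiding `v` is an invariant of the card `G - v`. -/
lemma card_starFinset_avoiding_congr
    (e : G.induce ({x | x ≠ v} : Set V) ≃g H.induce ({y | y ≠ w} : Set V)) :
    #{p ∈ starFinset G k | v ∉ insert p.1 p.2} =
      #{p ∈ starFinset H k | w ∉ insert p.1 p.2} := by
  let π : V ≃ V := Equiv.extendSubtype (p := fun x ↦ x ≠ v) (q := fun y ↦ y ≠ w) e.toEquiv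
  have hπ : ∀ x (hx : x ≠ v), π x = e ⟨x, hx⟩ := fun x hx ↦
    Equiv.extendSubtype_apply_of_mem (p := fun x ↦ x ≠ v) (q := fun y ↦ y ≠ w) e.toEquiv x hx
  have hw : π v = w := by
    by_contra h
    exact Equiv.extendSubtype_not_mem (p := fun x ↦ x ≠ v) (q := fun y ↦ y ≠ w)
      e.toEquiv v (by simp) h
  have hadj : ∀ x y, x ≠ v → y ≠ v → (H.Adj (π x) (π y) ↔ G.Adj x y) := by
    intro x y hx hy
    rw [hπ x hx, hπ y hy]
    exact e.map_rel_iff (a := ⟨x, hx⟩) (b := ⟨y, hy⟩)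
  refine card_equiv (π.prodCongr π.finsetCongr) ?_
  rintro ⟨c, s⟩
  rw [← hw]
  simp only [mem_filter, mem_starFinset, mem_insert, not_or, Equiv.prodCongr_apply, Prod.map_fst,
    Prod.map_snd, Equiv.finsetCongr_apply, mem_map_equiv, Equiv.symm_apply_apply, card_map,
    π.injective.eq_iff]
  refine and_congr_left fun ⟨hc, hs⟩ ↦ and_congr_right fun _ ↦ and_congr_right fun _ ↦
    π.forall_congr fun {x} ↦ ?_
  rw [Equiv.symm_apply_apply]
  refine forall_congr' fun hx ↦ (hadj c x (Ne.symm hc) ?_).symm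
  rintro rfl
  exact hs hx

/-- Kelly's lemma for stars. -/
lemma card_starFinset_congr (hk : k + 1 < Fintype.card V) (σ : V ≃ V)
    (hσ : ∀ v, Nonempty (G.induce ({x | x ≠ v} : Set V) ≃g
      H.induce ({y | y ≠ σ v} : Set V))) :
    #(starFinset G k) = #(starFinset H k) := by
  refine Nat.eq_of_mul_eq_mul_right (Nat.sub_pos_of_lt hk) ?_
  rw [← sum_card_starFinset_avoiding, ← sum_card_starFinset_avoiding]
  exact Fintype.sum_equiv σ _ _ fun v ↦ card_starFinset_avoiding_congr k (hσ v).some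

lemma card_starFinset_leaf_add_choose_degree_congr (hk : k + 1 < Fintype.card V) (σ : V ≃ V)
    (hσ : ∀ v, Nonempty (G.induce ({x | x ≠ v} : Set V) ≃g
      H.induce ({y | y ≠ σ v} : Set V)))
    (e : G.induce ({x | x ≠ v} : Set V) ≃g H.induce ({y | y ≠ w} : Set V)) :
    #{p ∈ starFinset G k | v ∈ p.2} + (G.degree v).choose k =
      #{p ∈ starFinset H k | w ∈ p.2} + (H.degree w).choose k := by
  have h := card_starFinset_congr k hk σ hσ
  rw [card_starFinset_eq_add G k v, card_starFinset_eq_add H k w,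
    card_starFinset_avoiding_congr k e, card_starFinset_center, card_starFinset_center] at h
  exact Nat.add_left_cancel h

lemma degree_congr_of_hypomorphic (hV : 2 < Fintype.card V) (σ : V ≃ V)
    (hσ : ∀ v, Nonempty (G.induce ({x | x ≠ v} : Set V) ≃g
      H.induce ({y | y ≠ σ v} : Set V)))
    (e : G.induce ({x | x ≠ v} : Set V) ≃g H.induce ({y | y ≠ w} : Set V)) :
    G.degree v = H.degree w := by
  have h := card_starFinset_leaf_add_choose_degree_congr 1 hV σ hσ e
  rw [card_starFinset_one_leaf, card_starFinset_one_leaf, Nat.choose_one_right,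
    Nat.choose_one_right] at h
  omega

variable (G v)

lemma natCard_stars_leaf :
    Nat.card {p : V × Finset V //
      p.1 ∉ p.2 ∧ #p.2 = k ∧ (∀ x ∈ p.2, G.Adj p.1 x) ∧ v ∈ p.2} =
    #{p ∈ starFinset G k | v ∈ p.2} :=
  Nat.subtype_card _ (by simp [mem_starFinset, and_assoc])

lemma natCard_stars_center :
    Nat.card {p : V × Finset V //
      p.1 ∉ p.2 ∧ #p.2 = k ∧ (∀ x ∈ p.2, G.Adj p.1 x) ∧ p.1 = v} =
    (G.degree v).choose k := by
  rw [← card_starFinset_center]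
  exact Nat.subtype_card _ (by simp [mem_starFinset, and_assoc])

end Stars

/-- Lemma 3.3(a): if `G` and `H` are hypomorphic graphs on `n` vertices, `3 ≤ m < n`,
and `v`, `w` are vertices with `G − v ≅ H − w`, then `G` and `H` contain the same number
of star subgraphs `K_{1,m-1}` with `v` (resp. `w`) as a leaf, and the same number with
`v` (resp. `w`) as center. -/
theorem stmt5 {n m : ℕ} (hm : 3 ≤ m) (hmn : m < n)
    (G H : SimpleGraph (Fin n)) (hGH : GHypomorphic G H)
    (v w : Fin n)
    (hvw : Nonempty (G.induce ({x | x ≠ v} : Set (Fin n)) ≃g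
                     H.induce ({y | y ≠ w} : Set (Fin n)))) :
    starLeafCount G m v = starLeafCount H m w ∧
    starCenterCount G m v = starCenterCount H m w := by
  obtain ⟨σ, hσ⟩ := hGH
  obtain ⟨e⟩ := hvw
  have hdeg := degree_congr_of_hypomorphic (by rw [Fintype.card_fin]; omega) σ hσ e
  have hleaf := card_starFinset_leaf_add_choose_degree_congr (m - 1)
    (by rw [Fintype.card_fin]; omega) σ hσ e
  rw [hdeg] at hleaf
  unfold starLeafCount starCenterCount
  rw [natCard_stars_leaf, natCard_stars_leaf, natCard_stars_center, natCard_stars_center, hdeg]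
  exact ⟨Nat.add_right_cancel hleaf, rfl⟩
end

section
/- Let G and H be hypomorphic triangle-free simple graphs on n vertices, let m satisfy 3 ≤ m < n, and let v be a vertex of G and w a vertex of H with G − v isomorphic to H − w. Then the number of m-element vertex subsets S of G containing v such that the induced subgraph G[S] is isomorphic to K_{1,m−1} with v a leaf of G[S] equals the corresponding number of induced stars in H with w as a leaf; likewise with 'center' in place of 'leaf'. -/
/-- The number of `m`-element vertex subsets `S` containing `v` such that the induced
subgraph `G[S]` is a star `K_{1,m-1}` in which `v` is a leaf: some `c ∈ S` distinct
from `v` is adjacent to all other vertices of `S`, and no two other vertices of `S`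
are adjacent. -/
noncomputable def indStarLeafCount {n : ℕ} (G : SimpleGraph (Fin n)) (m : ℕ) (v : Fin n) : ℕ :=
  Nat.card {S : Finset (Fin n) // S.card = m ∧ v ∈ S ∧
    ∃ c ∈ S, c ≠ v ∧ (∀ x ∈ S, x ≠ c → G.Adj c x) ∧
      (∀ x ∈ S, ∀ y ∈ S, x ≠ c → y ≠ c → ¬ G.Adj x y)}

/-- The number of `m`-element vertex subsets `S` containing `v` such that the induced
subgraph `G[S]` is a star `K_{1,m-1}` with `v` as center. -/
noncomputable def indStarCenterCount {n : ℕ} (G : SimpleGraph (Fin n)) (m : ℕ) (v : Fin n) : ℕ :=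
  Nat.card {S : Finset (Fin n) // S.card = m ∧ v ∈ S ∧
    (∀ x ∈ S, x ≠ v → G.Adj v x) ∧
    (∀ x ∈ S, ∀ y ∈ S, x ≠ v → y ≠ v → ¬ G.Adj x y)}

open Finset

/-- `S` induces a star with center `c` in `G`. -/
def IsIndStarAt {V : Type*} (G : SimpleGraph V) (S : Finset V) (c : V) : Prop :=
  (∀ x ∈ S, x ≠ c → G.Adj c x) ∧ (∀ x ∈ S, ∀ y ∈ S, x ≠ c → y ≠ c → ¬ G.Adj x y)

/-- `S` has `m` vertices and induces a star in `G`. -/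
def IsIndStar {V : Type*} (m : ℕ) (G : SimpleGraph V) (S : Finset V) : Prop :=
  S.card = m ∧ ∃ c ∈ S, IsIndStarAt G S c

/-- An isomorphism of two cards extends to a permutation of the whole vertex set. -/
theorem exists_perm_of_card_iso {V : Type*} [Finite V] {G H : SimpleGraph V} {v w : V}
    (h : Nonempty (G.induce ({x | x ≠ v} : Set V) ≃g H.induce ({y | y ≠ w} : Set V))) :
    ∃ τ : Equiv.Perm V, τ v = w ∧
      ∀ x y, x ≠ v → y ≠ v → (G.Adj x y ↔ H.Adj (τ x) (τ y)) := by
  classical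
  obtain ⟨φ⟩ := h
  let e : {x // x ≠ v} ≃ {y // y ≠ w} := φ.toEquiv
  refine ⟨e.extendSubtype, ?_, fun x y hx hy => ?_⟩
  · by_contra hne
    exact e.extendSubtype_not_mem v (by simp) hne
  · rw [e.extendSubtype_apply_of_mem x hx, e.extendSubtype_apply_of_mem y hy]
    exact (φ.map_adj_iff (v := ⟨x, hx⟩) (w := ⟨y, hy⟩)).symm

theorem IsIndStar.map {V : Type*} {m : ℕ} {G H : SimpleGraph V} {S : Finset V}
    (h : IsIndStar m G S) (τ : Equiv.Perm V)
    (hτ : ∀ x ∈ S, ∀ y ∈ S, (G.Adj x y ↔ H.Adj (τ x) (τ y))) :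
    IsIndStar m H (S.map τ.toEmbedding) := by
  obtain ⟨hS, c, hc, hadj, hind⟩ := h
  refine ⟨by simpa using hS, τ c, by simpa using hc, ?_, ?_⟩
  · intro x hx hxc
    obtain ⟨x, hxS, rfl⟩ := Finset.mem_map.1 hx
    exact (hτ c hc x hxS).1 (hadj x hxS fun h => hxc (congrArg τ h))
  · intro x hx y hy hxc hyc
    obtain ⟨x, hxS, rfl⟩ := Finset.mem_map.1 hx
    obtain ⟨y, hyS, rfl⟩ := Finset.mem_map.1 hy
    exact fun h => hind x hxS y hyS (fun h => hxc (congrArg τ h))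
      (fun h => hyc (congrArg τ h)) ((hτ x hxS y hyS).2 h)

open Classical in
/-- The number of induced stars on `m` vertices avoiding `v` is determined by the card at `v`,
as an inequality. -/
theorem card_isIndStar_notMem_le {V : Type*} [Fintype V] [DecidableEq V] {m : ℕ}
    {G H : SimpleGraph V} {v w : V}
    (h : Nonempty (G.induce ({x | x ≠ v} : Set V) ≃g H.induce ({y | y ≠ w} : Set V))) :
    #{S | IsIndStar m G S ∧ v ∉ S} ≤ #{S | IsIndStar m H S ∧ w ∉ S} := by
  obtain ⟨τ, rfl, hadj⟩ := exists_perm_of_card_iso h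
  refine Finset.card_le_card_of_injOn (fun S => S.map τ.toEmbedding) (fun S hS => ?_)
    ((Finset.map_injective _).injOn)
  simp only [coe_filter, mem_univ, true_and, Set.mem_ofPred_eq] at hS ⊢
  exact ⟨hS.1.map τ fun x hx y hy => hadj x y (ne_of_mem_of_not_mem hx hS.2)
    (ne_of_mem_of_not_mem hy hS.2), by simpa using hS.2⟩

open Classical in
/-- The number of induced stars on `m` vertices avoiding `v` is determined by the card at `v`. -/
theorem card_isIndStar_notMem {V : Type*} [Fintype V] [DecidableEq V] {m : ℕ}
    {G H : SimpleGraph V} {v w : V}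
    (h : Nonempty (G.induce ({x | x ≠ v} : Set V) ≃g H.induce ({y | y ≠ w} : Set V))) :
    #{S | IsIndStar m G S ∧ v ∉ S} = #{S | IsIndStar m H S ∧ w ∉ S} :=
  (card_isIndStar_notMem_le h).antisymm (card_isIndStar_notMem_le (h.map fun φ => φ.symm))

open Classical in
/-- Kelly's double count of pairs of an induced star and a vertex avoiding it. -/
theorem sum_card_isIndStar_notMem {V : Type*} [Fintype V] [DecidableEq V] (m : ℕ)
    (G : SimpleGraph V) :
    ∑ v, #{S | IsIndStar m G S ∧ v ∉ S} = #{S | IsIndStar m G S} * (Fintype.card V - m) := by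
  have h := Finset.sum_card_bipartiteAbove_eq_sum_card_bipartiteBelow
    (s := (univ : Finset V)) (t := {S | IsIndStar m G S}) (fun v S => v ∉ S)
  simp only [bipartiteAbove, bipartiteBelow, filter_filter] at h
  rw [h, Finset.sum_const_nat]
  intro S hS
  rw [← (mem_filter.1 hS).2.1, ← Finset.card_compl]
  congr 1
  ext x
  simp

open Classical in
/-- Kelly's lemma: the number of induced stars on `m` vertices through a vertex is
reconstructible. -/
theorem GHypomorphic.card_isIndStar_mem {n m : ℕ} (hmn : m < n) {G H : SimpleGraph (Fin n)}
    (hGH : GHypomorphic G H) {v w : Fin n}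
    (hvw : Nonempty (G.induce ({x | x ≠ v} : Set (Fin n)) ≃g
                     H.induce ({y | y ≠ w} : Set (Fin n)))) :
    #{S | IsIndStar m G S ∧ v ∈ S} = #{S | IsIndStar m H S ∧ w ∈ S} := by
  obtain ⟨σ, hσ⟩ := hGH
  have htotal : #{S | IsIndStar m G S} = #{S | IsIndStar m H S} := by
    refine Nat.eq_of_mul_eq_mul_right (Nat.sub_pos_of_lt hmn) ?_
    have hG := sum_card_isIndStar_notMem m G
    have hH := sum_card_isIndStar_notMem m H
    rw [Fintype.card_fin] at hG hH
    rw [← hG, ← hH, ← Equiv.sum_comp σ fun u => #{S | IsIndStar m H S ∧ u ∉ S}]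
    exact Finset.sum_congr rfl fun u _ => card_isIndStar_notMem (hσ u)
  have hG := Finset.card_filter_add_card_filter_not (s := {S | IsIndStar m G S}) (fun S => v ∈ S)
  have hH := Finset.card_filter_add_card_filter_not (s := {S | IsIndStar m H S}) (fun S => w ∈ S)
  simp only [filter_filter] at hG hH
  have := card_isIndStar_notMem (m := m) hvw
  omega

open Classical in
theorem indStarCenterCount_eq_card {n : ℕ} (G : SimpleGraph (Fin n)) (m : ℕ) (v : Fin n) :
    indStarCenterCount G m v = #{S | S.card = m ∧ v ∈ S ∧ IsIndStarAt G S v} := by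
  rw [indStarCenterCount, Nat.card_eq_fintype_card, Fintype.card_subtype]
  congr 1
  ext S
  rw [mem_filter, mem_filter, IsIndStarAt]

open Classical in
/-- In a triangle-free graph the stars centered at `v` correspond to sets of neighbors. -/
theorem indStarCenterCount_eq_choose {n : ℕ} {G : SimpleGraph (Fin n)} (hG : G.CliqueFree 3)
    (k : ℕ) (v : Fin n) : indStarCenterCount G (k + 1) v = (G.degree v).choose k := by
  rw [indStarCenterCount_eq_card, ← SimpleGraph.card_neighborFinset_eq_degree,
    ← Finset.card_powersetCard]
  refine Finset.card_nbij' (fun S => S.erase v) (fun T => insert v T) ?_ ?_ ?_ ?_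
  · intro S hS
    obtain ⟨hcard, hv, hadj, -⟩ : S.card = k + 1 ∧ v ∈ S ∧ IsIndStarAt G S v := by simpa using hS
    simp only [Finset.mem_coe, mem_powersetCard]
    refine ⟨fun x hx => ?_, by rw [card_erase_of_mem hv, hcard, Nat.add_sub_cancel]⟩
    rw [SimpleGraph.mem_neighborFinset]
    exact hadj x (mem_of_mem_erase hx) (ne_of_mem_erase hx)
  · intro T hT
    obtain ⟨hsub, hcard⟩ := mem_powersetCard.1 (Finset.mem_coe.1 hT)
    have hadj : ∀ x ∈ T, G.Adj v x := fun x hx => (G.mem_neighborFinset v x).1 (hsub hx)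
    have hv : v ∉ T := fun hv => G.loopless.irrefl v (hadj v hv)
    have hins : ∀ x ∈ insert v T, x ≠ v → G.Adj v x := fun x hx hxv =>
      hadj x ((mem_insert.1 hx).resolve_left hxv)
    simp only [coe_filter, mem_univ, true_and, Set.mem_ofPred_eq]
    refine ⟨by rw [card_insert_of_notMem hv, hcard], mem_insert_self v T, hins, ?_⟩
    intro x hx y hy hxv hyv hxy
    exact hG {v, x, y}
      (SimpleGraph.is3Clique_triple_iff.2 ⟨hins x hx hxv, hins y hy hyv, hxy⟩)
  · intro S hS
    exact insert_erase (mem_filter.1 (Finset.mem_coe.1 hS)).2.2.1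
  · intro T hT
    refine erase_insert fun hv => G.loopless.irrefl v ?_
    exact (G.mem_neighborFinset v v).1 ((mem_powersetCard.1 (Finset.mem_coe.1 hT)).1 hv)

open Classical in
/-- An induced star on two vertices through `v` has `v` as a center. -/
theorem card_isIndStar_two_mem {n : ℕ} (G : SimpleGraph (Fin n)) (v : Fin n) :
    #{S | IsIndStar 2 G S ∧ v ∈ S} = indStarCenterCount G 2 v := by
  rw [indStarCenterCount_eq_card]
  congr 1
  ext S
  simp only [mem_filter, mem_univ, true_and]
  constructor
  · rintro ⟨⟨hcard, c, hc, hadj, hind⟩, hv⟩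
    refine ⟨hcard, hv, ?_⟩
    by_cases hvc : v = c
    · exact hvc ▸ ⟨hadj, hind⟩
    have hS : S = {v, c} := by
      refine (Finset.eq_of_subset_of_card_le ?_ ?_).symm
      · simp [Finset.insert_subset_iff, hv, hc]
      · rw [hcard, card_pair hvc]
    have hcv := hadj v hv hvc
    subst hS
    refine ⟨fun x hx hxv => ?_, fun x hx y hy hxv hyv => ?_⟩
    · obtain rfl : x = c := by simpa [hxv] using hx
      exact hcv.symm
    · obtain rfl : x = c := by simpa [hxv] using hx
      obtain rfl : y = x := by simpa [hyv] using hy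
      exact G.loopless.irrefl y
  · rintro ⟨hcard, hv, hstar⟩
    exact ⟨⟨hcard, v, hv, hstar⟩, hv⟩

open Classical in
/-- On at least three vertices, `v` is exactly one of leaf or center in an induced star
through it. -/
theorem card_isIndStar_mem_eq_add {n m : ℕ} (hm : 3 ≤ m) (G : SimpleGraph (Fin n)) (v : Fin n) :
    #{S | IsIndStar m G S ∧ v ∈ S} = indStarLeafCount G m v + indStarCenterCount G m v := by
  rw [indStarCenterCount_eq_card, indStarLeafCount, Nat.card_eq_fintype_card,
    Fintype.card_subtype, ← Finset.card_union_of_disjoint]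
  · congr 1
    ext S
    simp only [mem_filter, mem_univ, true_and, mem_union]
    constructor
    · rintro ⟨⟨hcard, c, hc, hstar⟩, hv⟩
      by_cases hcv : c = v
      · exact Or.inr ⟨hcard, hv, hcv ▸ hstar⟩
      · exact Or.inl ⟨hcard, hv, c, hc, hcv, hstar⟩
    · rintro (⟨hcard, hv, c, hc, -, hstar⟩ | ⟨hcard, hv, hstar⟩)
      · exact ⟨⟨hcard, c, hc, hstar⟩, hv⟩
      · exact ⟨⟨hcard, v, hv, hstar⟩, hv⟩
  · refine Finset.disjoint_filter.2 ?_
    rintro S - ⟨hcard, hv, c, hc, hcv, -, hind⟩ ⟨-, -, hadj, -⟩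
    obtain ⟨x, hx, hxn⟩ : ∃ x ∈ S, x ∉ ({v, c} : Finset (Fin n)) :=
      Finset.exists_mem_notMem_of_card_lt_card (by
        have := Finset.card_le_two (a := v) (b := c)
        omega)
    simp only [mem_insert, mem_singleton, not_or] at hxn
    exact hind v hv x hx (Ne.symm hcv) hxn.2 (hadj x hx hxn.1)

/-- Lemma 3.3(a), triangle-free case: if `G` and `H` are hypomorphic triangle-free
graphs on `n` vertices, `3 ≤ m < n`, and `v`, `w` are vertices with `G − v ≅ H − w`,
then `G` and `H` contain the same number of induced stars on `m` vertices with `v`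
(resp. `w`) as a leaf, and likewise with `v` (resp. `w`) as center. -/
theorem stmt6 {n m : ℕ} (hm : 3 ≤ m) (hmn : m < n)
    (G H : SimpleGraph (Fin n))
    (hGtf : G.CliqueFree 3) (hHtf : H.CliqueFree 3)
    (hGH : GHypomorphic G H) (v w : Fin n)
    (hvw : Nonempty (G.induce ({x | x ≠ v} : Set (Fin n)) ≃g
                     H.induce ({y | y ≠ w} : Set (Fin n)))) :
    indStarLeafCount G m v = indStarLeafCount H m w ∧
    indStarCenterCount G m v = indStarCenterCount H m w := by
  classical
  have hdeg : G.degree v = H.degree w := by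
    have h := hGH.card_isIndStar_mem (m := 2) (by omega) hvw
    rw [card_isIndStar_two_mem, card_isIndStar_two_mem, indStarCenterCount_eq_choose hGtf,
      indStarCenterCount_eq_choose hHtf] at h
    simpa using h
  have hcenter : indStarCenterCount G m v = indStarCenterCount H m w := by
    obtain ⟨k, rfl⟩ : ∃ k, m = k + 1 := ⟨m - 1, by omega⟩
    rw [indStarCenterCount_eq_choose hGtf, indStarCenterCount_eq_choose hHtf, hdeg]
  have htotal := hGH.card_isIndStar_mem hmn hvw
  rw [card_isIndStar_mem_eq_add hm, card_isIndStar_mem_eq_add hm] at htotal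
  exact ⟨by omega, hcenter⟩
end

section
/- Let G and H be hypomorphic simple graphs on n ≥ 3 vertices, and let v be a vertex of G and w a vertex of H with G − v isomorphic to H − w. Then the number of 3-element vertex subsets {v, x, y} of G such that vx and xy are edges of G and vy is not an edge of G (i.e., induced paths of length 2 in G starting at v) equals the corresponding number of induced paths of length 2 in H starting at w. -/
/-- The number of induced paths of length 2 in `G` starting at `v`: three-element vertex
subsets `{v, x, y}` with `vx` and `xy` edges but `vy` not an edge.  (Each such subset
determines the pair `(x, y)` uniquely, so we count such ordered pairs.) -/
noncomputable def ip2 {n : ℕ} (G : SimpleGraph (Fin n)) (v : Fin n) : ℕ :=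
  Nat.card {p : Fin n × Fin n //
    G.Adj v p.1 ∧ G.Adj p.1 p.2 ∧ ¬ G.Adj v p.2 ∧ p.2 ≠ v}

/-- Summing over the vertices other than `v`. -/
lemma sum_ne_eq_sum_sub {V : Type*} [Fintype V] [DecidableEq V] (v : V) (f : V → ℤ) :
    ∑ x : ({x | x ≠ v} : Set V), f x = ∑ x, f x - f v := by
  rw [← Finset.sum_erase_eq_sub (Finset.mem_univ v)]
  exact (Finset.sum_subtype _ (by simp) f).symm

namespace SimpleGraph

section Counts

variable {V : Type*}

open Classical in
/-- The `0`-`1` indicator of adjacency. -/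
noncomputable def adjInd (G : SimpleGraph V) (x y : V) : ℤ := if G.Adj x y then 1 else 0

lemma adjInd_comm (G : SimpleGraph V) (x y : V) : G.adjInd x y = G.adjInd y x := by
  unfold adjInd
  congr 1
  exact propext (G.adj_comm x y)

@[simp] lemma adjInd_self (G : SimpleGraph V) (x : V) : G.adjInd x x = 0 := by
  simp [adjInd]

lemma adjInd_eq_zero_or_one (G : SimpleGraph V) (x y : V) :
    G.adjInd x y = 0 ∨ G.adjInd x y = 1 := by
  unfold adjInd; split_ifs <;> simp

lemma adjInd_mul_self (G : SimpleGraph V) (x y : V) :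
    G.adjInd x y * G.adjInd x y = G.adjInd x y := by
  rcases G.adjInd_eq_zero_or_one x y with h | h <;> simp [h]

@[simp] lemma adjInd_induce (G : SimpleGraph V) (s : Set V) (x y : s) :
    (G.induce s).adjInd x y = G.adjInd x y := by
  unfold adjInd
  congr 1

lemma Iso.adjInd_apply {W : Type*} {G : SimpleGraph V} {H : SimpleGraph W} (e : G ≃g H)
    (x y : V) : H.adjInd (e x) (e y) = G.adjInd x y := by
  unfold adjInd
  congr 1
  exact propext e.map_adj_iff

variable [Fintype V]

/-- The degree of `x`, as an integer. -/
noncomputable def degSum (G : SimpleGraph V) (x : V) : ℤ := ∑ y, G.adjInd x y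

lemma sum_adjInd_left (G : SimpleGraph V) (v : V) : ∑ x, G.adjInd x v = G.degSum v :=
  Finset.sum_congr rfl fun x _ => G.adjInd_comm x v

/-- The number of ordered pairs of adjacent vertices. -/
noncomputable def dartSum (G : SimpleGraph V) : ℤ := ∑ x, G.degSum x

/-- The sum of the squares of the degrees. -/
noncomputable def degSqSum (G : SimpleGraph V) : ℤ := ∑ x, G.degSum x ^ 2

/-- The number of ordered pairs that form a triangle with `x`. -/
noncomputable def triangleSumAt (G : SimpleGraph V) (x : V) : ℤ :=
  ∑ y, ∑ z, G.adjInd x y * G.adjInd y z * G.adjInd x z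

/-- The number of ordered triangles. -/
noncomputable def triangleSum (G : SimpleGraph V) : ℤ := ∑ x, G.triangleSumAt x

section Iso

variable {W : Type*} [Fintype W] {G : SimpleGraph V} {H : SimpleGraph W}

lemma Iso.degSum_apply (e : G ≃g H) (x : V) : H.degSum (e x) = G.degSum x := by
  unfold degSum
  rw [← e.toEquiv.sum_comp]
  exact Finset.sum_congr rfl fun y _ => e.adjInd_apply x y

lemma Iso.dartSum_eq (e : G ≃g H) : G.dartSum = H.dartSum := by
  unfold dartSum
  rw [← e.toEquiv.sum_comp H.degSum]
  exact Finset.sum_congr rfl fun x _ => (e.degSum_apply x).symm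

lemma Iso.degSqSum_eq (e : G ≃g H) : G.degSqSum = H.degSqSum := by
  unfold degSqSum
  rw [← e.toEquiv.sum_comp fun x => H.degSum x ^ 2]
  exact Finset.sum_congr rfl fun x _ => congrArg (· ^ 2) (e.degSum_apply x).symm

lemma Iso.triangleSumAt_apply (e : G ≃g H) (x : V) :
    H.triangleSumAt (e x) = G.triangleSumAt x := by
  unfold triangleSumAt
  rw [← e.toEquiv.sum_comp]
  refine Finset.sum_congr rfl fun y _ => ?_
  rw [← e.toEquiv.sum_comp]
  refine Finset.sum_congr rfl fun z _ => ?_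
  change H.adjInd (e x) (e y) * H.adjInd (e y) (e z) * H.adjInd (e x) (e z) = _
  simp only [e.adjInd_apply]

lemma Iso.triangleSum_eq (e : G ≃g H) : G.triangleSum = H.triangleSum := by
  unfold triangleSum
  rw [← e.toEquiv.sum_comp H.triangleSumAt]
  exact Finset.sum_congr rfl fun x _ => (e.triangleSumAt_apply x).symm

end Iso

section Card

variable [DecidableEq V] (G : SimpleGraph V) (v : V)

lemma degSum_card (x : ({x | x ≠ v} : Set V)) :
    (G.induce {x | x ≠ v}).degSum x = G.degSum x - G.adjInd x v := by
  simp only [degSum, adjInd_induce]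
  exact sum_ne_eq_sum_sub v fun y => G.adjInd x y

lemma dartSum_card :
    (G.induce {x | x ≠ v}).dartSum = G.dartSum - 2 * G.degSum v := by
  simp only [dartSum, degSum_card]
  rw [sum_ne_eq_sum_sub v fun x => G.degSum x - G.adjInd x v, Finset.sum_sub_distrib,
    sum_adjInd_left, adjInd_self]
  ring

lemma degSqSum_card :
    (G.induce {x | x ≠ v}).degSqSum =
      G.degSqSum - G.degSum v ^ 2 + G.degSum v - 2 * ∑ x, G.adjInd v x * G.degSum x := by
  simp only [degSqSum, degSum_card]
  rw [sum_ne_eq_sum_sub v fun x => (G.degSum x - G.adjInd x v) ^ 2]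
  have h : ∀ x, (G.degSum x - G.adjInd x v) ^ 2 =
      G.degSum x ^ 2 + G.adjInd v x - 2 * (G.adjInd v x * G.degSum x) := fun x => by
    rw [G.adjInd_comm x v]
    linear_combination G.adjInd_mul_self v x
  simp only [h, Finset.sum_sub_distrib, Finset.sum_add_distrib, ← Finset.mul_sum, adjInd_self]
  change _ + G.degSum v - _ - _ = _
  ring

lemma triangleSum_card :
    (G.induce {x | x ≠ v}).triangleSum = G.triangleSum - 3 * G.triangleSumAt v := by
  have hz : ∀ x y, ∑ z : ({x | x ≠ v} : Set V),
      G.adjInd x y * G.adjInd y z * G.adjInd x z =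
      ∑ z, G.adjInd x y * G.adjInd y z * G.adjInd x z -
        G.adjInd x y * G.adjInd y v * G.adjInd x v := fun x y =>
    sum_ne_eq_sum_sub v fun z => G.adjInd x y * G.adjInd y z * G.adjInd x z
  have hy : ∀ x, ∑ y : ({x | x ≠ v} : Set V),
      (∑ z, G.adjInd x y * G.adjInd y z * G.adjInd x z -
        G.adjInd x y * G.adjInd y v * G.adjInd x v) =
      G.triangleSumAt x - 2 * ∑ y, G.adjInd v x * G.adjInd x y * G.adjInd v y := fun x => by
    rw [sum_ne_eq_sum_sub v fun y => ∑ z, G.adjInd x y * G.adjInd y z * G.adjInd x z -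
        G.adjInd x y * G.adjInd y v * G.adjInd x v, Finset.sum_sub_distrib]
    have h₁ : ∑ y, G.adjInd x y * G.adjInd y v * G.adjInd x v =
        ∑ y, G.adjInd v x * G.adjInd x y * G.adjInd v y :=
      Finset.sum_congr rfl fun y _ => by
        rw [G.adjInd_comm y v, G.adjInd_comm x v]; ring
    have h₂ : ∑ z, G.adjInd x v * G.adjInd v z * G.adjInd x z =
        ∑ y, G.adjInd v x * G.adjInd x y * G.adjInd v y :=
      Finset.sum_congr rfl fun y _ => by rw [G.adjInd_comm x v]; ring
    rw [h₁, h₂, adjInd_self, triangleSumAt]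
    ring
  simp only [triangleSum, triangleSumAt, adjInd_induce, hz]
  simp only [hy]
  rw [sum_ne_eq_sum_sub v fun x =>
    G.triangleSumAt x - 2 * ∑ y, G.adjInd v x * G.adjInd x y * G.adjInd v y,
    Finset.sum_sub_distrib, ← Finset.mul_sum]
  simp only [adjInd_self, zero_mul, Finset.sum_const_zero]
  simp only [triangleSumAt]
  ring

end Card

open Classical in
lemma natCard_inducedPath_eq (G : SimpleGraph V) (v : V) :
    (Nat.card {p : V × V // G.Adj v p.1 ∧ G.Adj p.1 p.2 ∧ ¬ G.Adj v p.2 ∧ p.2 ≠ v} : ℤ) =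
      ∑ x, G.adjInd v x * G.degSum x - G.degSum v - G.triangleSumAt v := by
  have h : ∀ x y, (if G.Adj v x ∧ G.Adj x y ∧ ¬ G.Adj v y ∧ y ≠ v then (1 : ℤ) else 0) =
      G.adjInd v x * G.adjInd x y - (if y = v then G.adjInd v x else 0) -
        G.adjInd v x * G.adjInd x y * G.adjInd v y := fun x y => by
    by_cases hy : y = v
    · subst hy
      simp [G.adjInd_comm x y, adjInd_mul_self]
    · by_cases h₁ : G.Adj v x <;> by_cases h₂ : G.Adj x y <;> by_cases h₃ : G.Adj v y <;>
        simp [adjInd, h₁, h₂, h₃, hy]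
  rw [Nat.card_eq_fintype_card, Fintype.card_subtype, Finset.card_filter]
  push_cast
  rw [Fintype.sum_prod_type]
  simp only [h, Finset.sum_sub_distrib, Finset.sum_ite_eq', Finset.mem_univ, if_true,
    ← Finset.mul_sum]
  simp only [triangleSumAt, degSum]

end Counts

lemma triangleSum_fin_three (G : SimpleGraph (Fin 3)) :
    G.triangleSum = if G.dartSum = 6 then 6 else 0 := by
  simp only [triangleSum, triangleSumAt, dartSum, degSum, Fin.sum_univ_three, adjInd_self,
    G.adjInd_comm 1 0, G.adjInd_comm 2 0, G.adjInd_comm 2 1]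
  rcases G.adjInd_eq_zero_or_one 0 1 with h₁ | h₁ <;>
  rcases G.adjInd_eq_zero_or_one 0 2 with h₂ | h₂ <;>
  rcases G.adjInd_eq_zero_or_one 1 2 with h₃ | h₃ <;>
  simp [h₁, h₂, h₃]

end SimpleGraph

namespace GHypomorphic

variable {n : ℕ} {G H : SimpleGraph (Fin n)}

lemma dartSum_eq (hn : 3 ≤ n) (h : GHypomorphic G H) : G.dartSum = H.dartSum := by
  obtain ⟨σ, hσ⟩ := h
  have key : ∀ v, G.dartSum - 2 * G.degSum v = H.dartSum - 2 * H.degSum (σ v) := fun v => by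
    rw [← G.dartSum_card, ← H.dartSum_card]
    exact (hσ v).some.dartSum_eq
  have hs := Finset.sum_congr (rfl : Finset.univ = Finset.univ) fun v _ => key v
  rw [Finset.sum_sub_distrib, Finset.sum_sub_distrib, ← Finset.mul_sum, ← Finset.mul_sum,
    σ.sum_comp H.degSum] at hs
  simp only [Finset.sum_const, Finset.card_univ, Fintype.card_fin, nsmul_eq_mul] at hs
  change n * G.dartSum - 2 * G.dartSum = n * H.dartSum - 2 * H.dartSum at hs
  have hn' : (n : ℤ) - 2 ≠ 0 := by omega
  exact mul_left_cancel₀ hn' (by linear_combination hs)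

lemma degSqSum_eq (hn : 3 ≤ n) (h : GHypomorphic G H) : G.degSqSum = H.degSqSum := by
  have he := h.dartSum_eq hn
  obtain ⟨σ, hσ⟩ := h
  have key : ∀ v, G.degSum v = H.degSum (σ v) := fun v => by
    have := (hσ v).some.dartSum_eq
    rw [G.dartSum_card, H.dartSum_card] at this
    omega
  simp only [SimpleGraph.degSqSum, key]
  exact σ.sum_comp fun x => H.degSum x ^ 2

lemma triangleSum_eq (hn : 3 ≤ n) (h : GHypomorphic G H) : G.triangleSum = H.triangleSum := by
  rcases hn.eq_or_lt with rfl | hn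
  · rw [G.triangleSum_fin_three, H.triangleSum_fin_three, h.dartSum_eq le_rfl]
  obtain ⟨σ, hσ⟩ := h
  have key : ∀ v, G.triangleSum - 3 * G.triangleSumAt v =
      H.triangleSum - 3 * H.triangleSumAt (σ v) := fun v => by
    rw [← G.triangleSum_card, ← H.triangleSum_card]
    exact (hσ v).some.triangleSum_eq
  have hs := Finset.sum_congr (rfl : Finset.univ = Finset.univ) fun v _ => key v
  rw [Finset.sum_sub_distrib, Finset.sum_sub_distrib, ← Finset.mul_sum, ← Finset.mul_sum,
    σ.sum_comp H.triangleSumAt] at hs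
  simp only [Finset.sum_const, Finset.card_univ, Fintype.card_fin, nsmul_eq_mul] at hs
  change n * G.triangleSum - 3 * G.triangleSum = n * H.triangleSum - 3 * H.triangleSum at hs
  have hn' : (n : ℤ) - 3 ≠ 0 := by omega
  exact mul_left_cancel₀ hn' (by linear_combination hs)

end GHypomorphic

/-- Lemma 3.3(b): if `G` and `H` are hypomorphic graphs on `n ≥ 3` vertices and
`v`, `w` are vertices with `G − v ≅ H − w`, then the number of induced paths of
length 2 starting at `v` in `G` equals the number starting at `w` in `H`. -/
theorem stmt7 {n : ℕ} (hn : 3 ≤ n)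
    (G H : SimpleGraph (Fin n)) (hGH : GHypomorphic G H)
    (v w : Fin n)
    (hvw : Nonempty (G.induce ({x | x ≠ v} : Set (Fin n)) ≃g
                     H.induce ({y | y ≠ w} : Set (Fin n)))) :
    ip2 G v = ip2 H w := by
  obtain ⟨e⟩ := hvw
  have hE := e.dartSum_eq
  have hD := e.degSqSum_eq
  have hT := e.triangleSum_eq
  rw [G.dartSum_card, H.dartSum_card, hGH.dartSum_eq hn] at hE
  rw [G.degSqSum_card, H.degSqSum_card, hGH.degSqSum_eq hn] at hD
  rw [G.triangleSum_card, H.triangleSum_card, hGH.triangleSum_eq hn] at hT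
  have hd : G.degSum v = H.degSum w := by omega
  rw [hd] at hD
  unfold ip2
  zify
  rw [G.natCard_inducedPath_eq, H.natCard_inducedPath_eq]
  linarith
end

section
/- Let H be a simple graph, let u and v be distinct adjacent vertices of H, and let P be the graph obtained from H by deleting the edge uv. Let t denote the number of common neighbors of u and v in P. Then: ip(2,H,u) = ip(2,P,u) − 2t + deg_H(v) − 1; ip(2,H,v) = ip(2,P,v) − 2t + deg_H(u) − 1; the number of triangles of H containing u equals the number of triangles of P containing u plus t; and the number of triangles of H containing v equals the number of triangles of P containing v plus t. -/
/-- The degree of a vertex in a simple graph. -/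
noncomputable def degC {V : Type*} (G : SimpleGraph V) (v : V) : ℕ :=
  Nat.card {x : V // G.Adj v x}

/-- The number of triangles of `G` containing the vertex `u`. -/
noncomputable def triCount {n : ℕ} (G : SimpleGraph (Fin n)) (u : Fin n) : ℕ :=
  Nat.card {s : Finset (Fin n) // u ∈ s ∧ s.card = 3 ∧
    ∀ x ∈ s, ∀ y ∈ s, x ≠ y → G.Adj x y}

open Classical in
theorem ip2_add_two_mul_card_commonNeighbors {n : ℕ} {H P : SimpleGraph (Fin n)} {u v : Fin n}
    (huv : H.Adj u v)
    (hP : ∀ a b, P.Adj a b ↔ H.Adj a b ∧ ¬ (a = u ∧ b = v) ∧ ¬ (a = v ∧ b = u)) :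
    ip2 H u + 2 * Nat.card {x : Fin n // P.Adj u x ∧ P.Adj v x} + 1 = ip2 P u + degC H v := by
  have hne : u ≠ v := huv.ne
  unfold ip2 degC
  simp only [Nat.card_eq_fintype_card, Fintype.card_subtype]
  set A := Finset.univ.filter fun p : Fin n × Fin n =>
    H.Adj u p.1 ∧ H.Adj p.1 p.2 ∧ ¬ H.Adj u p.2 ∧ p.2 ≠ u with hA
  set B := Finset.univ.filter fun p : Fin n × Fin n =>
    P.Adj u p.1 ∧ P.Adj p.1 p.2 ∧ ¬ P.Adj u p.2 ∧ p.2 ≠ u with hB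
  set C := Finset.univ.filter fun x : Fin n => P.Adj u x ∧ P.Adj v x with hC
  set D := Finset.univ.filter fun x : Fin n => H.Adj v x with hD
  have hCD : insert u C ⊆ D := by
    intro x
    simp only [hC, hD, Finset.mem_insert, Finset.mem_filter, Finset.mem_univ, true_and, hP]
    rintro (rfl | h)
    exacts [huv.symm, h.2.1]
  have huC : u ∉ C := by simp [hC]
  have hE := Finset.card_sdiff_add_card_eq_card hCD
  rw [Finset.card_insert_of_notMem huC] at hE
  have hCcard : (C.image fun x => (x, v)).card = C.card :=
    Finset.card_image_of_injective _ fun a b h => (Prod.ext_iff.1 h).1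
  have hEcard : ((D \ insert u C).image fun y => (v, y)).card = (D \ insert u C).card :=
    Finset.card_image_of_injective _ fun a b h => (Prod.ext_iff.1 h).2
  have hAC : Disjoint A (C.image fun x => (x, v)) := by
    rw [Finset.disjoint_left]
    rintro ⟨x, y⟩ h h'
    simp only [hA, hC, Finset.mem_image, Finset.mem_filter, Prod.mk.injEq] at h h'
    grind
  have hBE : Disjoint B ((D \ insert u C).image fun y => (v, y)) := by
    rw [Finset.disjoint_left]
    rintro ⟨x, y⟩ h h'
    simp only [hB, Finset.mem_image, Finset.mem_filter, Prod.mk.injEq] at h h'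
    grind
  have hunion : A ∪ (C.image fun x => (x, v)) =
      B ∪ ((D \ insert u C).image fun y => (v, y)) := by
    ext ⟨x, y⟩
    have h₁ := H.adj_comm x y
    have h₂ := H.adj_comm x v
    have h₃ := H.loopless.irrefl v
    simp only [hA, hB, hC, hD, Finset.mem_union, Finset.mem_image, Finset.mem_filter,
      Finset.mem_univ, true_and, Prod.mk.injEq, Finset.mem_sdiff, Finset.mem_insert, hP]
    grind
  have hcard := congrArg Finset.card hunion
  rw [Finset.card_union_of_disjoint hAC, Finset.card_union_of_disjoint hBE] at hcard
  omega

open Classical in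
theorem triCount_eq_add_card_commonNeighbors {n : ℕ} {H P : SimpleGraph (Fin n)} {u v : Fin n}
    (huv : H.Adj u v)
    (hP : ∀ a b, P.Adj a b ↔ H.Adj a b ∧ ¬ (a = u ∧ b = v) ∧ ¬ (a = v ∧ b = u)) :
    triCount H u = triCount P u + Nat.card {x : Fin n // P.Adj u x ∧ P.Adj v x} := by
  have hne : u ≠ v := huv.ne
  unfold triCount
  simp only [Nat.card_eq_fintype_card, Fintype.card_subtype]
  set C := Finset.univ.filter fun x : Fin n => P.Adj u x ∧ P.Adj v x with hC
  have hmemC : ∀ x ∈ C, H.Adj u x ∧ H.Adj v x ∧ x ≠ u ∧ x ≠ v := by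
    intro x hx
    simp only [hC, Finset.mem_filter, Finset.mem_univ, true_and, hP] at hx
    exact ⟨hx.1.1, hx.2.1, hx.1.1.ne', hx.2.1.ne'⟩
  have hCcard : (C.image fun x => ({u, v, x} : Finset (Fin n))).card = C.card := by
    refine Finset.card_image_of_injOn fun a ha b _ h => ?_
    have ha' := hmemC a ha
    have hab : a ∈ ({u, v, b} : Finset (Fin n)) := h ▸ (by simp)
    simpa [ha'.2.2.1, ha'.2.2.2] using hab
  rw [← hCcard, ← Finset.card_union_of_disjoint]
  · congr 1
    ext s
    simp only [Finset.mem_union, Finset.mem_image, Finset.mem_filter, Finset.mem_univ, true_and]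
    constructor
    · rintro ⟨hu, h3, hs⟩
      by_cases hv : v ∈ s
      · right
        obtain ⟨x, hx⟩ : ∃ x, (s.erase u).erase v = {x} := by
          rw [← Finset.card_eq_one, Finset.card_erase_of_mem (by simp [hv, hne.symm]),
            Finset.card_erase_of_mem hu, h3]
        have hxs : x ∈ (s.erase u).erase v := by simp [hx]
        simp only [Finset.mem_erase] at hxs
        refine ⟨x, ?_, ?_⟩
        · have h₁ := hs u hu x hxs.2.2 (Ne.symm hxs.2.1)
          have h₂ := hs v hv x hxs.2.2 (Ne.symm hxs.1)
          simp only [hC, Finset.mem_filter, Finset.mem_univ, true_and, hP]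
          grind
        · rw [← hx, Finset.insert_erase (by simp [hv, hne.symm]), Finset.insert_erase hu]
      · left
        refine ⟨hu, h3, fun x hx y hy hxy => (hP x y).2 ⟨hs x hx y hy hxy, ?_, ?_⟩⟩
        · rintro ⟨-, rfl⟩
          exact hv hy
        · rintro ⟨rfl, -⟩
          exact hv hx
    · rintro (⟨hu, h3, hs⟩ | ⟨x, hx, rfl⟩)
      · exact ⟨hu, h3, fun x hx y hy hxy => ((hP x y).1 (hs x hx y hy hxy)).1⟩
      · obtain ⟨h₁, h₂, h₃, h₄⟩ := hmemC x hx
        refine ⟨by simp, Finset.card_eq_three.2 ⟨u, v, x, hne, h₃.symm, h₄.symm, rfl⟩, ?_⟩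
        have h₅ := h₁.symm
        have h₆ := h₂.symm
        have h₇ := huv.symm
        simp only [Finset.mem_insert, Finset.mem_singleton]
        grind
  · rw [Finset.disjoint_left]
    intro s hs hs'
    simp only [Finset.mem_image, Finset.mem_filter, Finset.mem_univ, true_and] at hs hs'
    obtain ⟨x, -, rfl⟩ := hs'
    exact ((hP u v).1 (hs.2.2 u (by simp) v (by simp) hne)).2.1 ⟨rfl, rfl⟩

/-- Lemma 4.15(d)(ii): if `u` and `v` are adjacent in `H`, `P = H - uv` and `t` is the
number of common neighbors of `u` and `v` in `P`, then
`ip(2,H,u) = ip(2,P,u) − 2t + deg_H(v) − 1`, symmetrically for `v`, and the number of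
triangles of `H` at `u` (resp. `v`) exceeds that of `P` by exactly `t`. -/
theorem stmt11 {n : ℕ} (H : SimpleGraph (Fin n)) (u v : Fin n)
    (huv : H.Adj u v)
    (P : SimpleGraph (Fin n)) (hP : P = H.deleteEdges {s(u, v)})
    (t : ℕ) (ht : t = Nat.card {x : Fin n // P.Adj u x ∧ P.Adj v x}) :
    (ip2 H u : ℤ) = (ip2 P u : ℤ) - 2 * t + degC H v - 1 ∧
    (ip2 H v : ℤ) = (ip2 P v : ℤ) - 2 * t + degC H u - 1 ∧
    triCount H u = triCount P u + t ∧
    triCount H v = triCount P v + t := by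
  have hadj : ∀ a b, P.Adj a b ↔ H.Adj a b ∧ ¬ (a = u ∧ b = v) ∧ ¬ (a = v ∧ b = u) := by
    intro a b
    simp [hP, SimpleGraph.deleteEdges_adj]
  have hadj' : ∀ a b, P.Adj a b ↔ H.Adj a b ∧ ¬ (a = v ∧ b = u) ∧ ¬ (a = u ∧ b = v) := by
    intro a b
    rw [hadj, and_comm (a := ¬ (a = u ∧ b = v))]
  have ht' : t = Nat.card {x : Fin n // P.Adj v x ∧ P.Adj u x} := by
    simp only [ht, and_comm]
  have h₁ := ip2_add_two_mul_card_commonNeighbors huv hadj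
  have h₂ := ip2_add_two_mul_card_commonNeighbors huv.symm hadj'
  have h₃ := triCount_eq_add_card_commonNeighbors huv hadj
  have h₄ := triCount_eq_add_card_commonNeighbors huv.symm hadj'
  rw [← ht] at h₁ h₃
  rw [← ht'] at h₂ h₄
  exact ⟨by omega, by omega, h₃, h₄⟩
end

section
/- Let G be a digraph and let H₁ and H₂ be digraphs each da-hypomorphic to G. Let u₁ ≠ v₁ be vertices of H₁ and u₂ ≠ v₂ be vertices of H₂, and let Pᵢ denote Hᵢ with all arcs between uᵢ and vᵢ deleted (i = 1, 2). Then there exists an isomorphism ψ from H₁ to H₂ with ψ({u₁, v₁}) = {u₂, v₂} if and only if there exists an isomorphism φ from P₁ to P₂ with φ({u₁, v₁}) = {u₂, v₂} satisfying dt_{H₁}(x) = dt_{H₂}(φ(x)) for each x ∈ {u₁, v₁}. -/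
/-- The digraph obtained from `D` by deleting all arcs between `u` and `v`. -/
def delPair {V : Type*} (D : V → V → Prop) (u v : V) : V → V → Prop :=
  fun x y => D x y ∧ ¬((x = u ∧ y = v) ∨ (x = v ∧ y = u))

/-- If two predicates of equal cardinality correspond under a bijection at every point except
possibly `v`, then they correspond at `v` too. -/
lemma iff_apply_of_card_eq {V W : Type*} [Finite V] (φ : V ≃ W) {p : V → Prop} {q : W → Prop}
    (v : V) (hne : ∀ w, w ≠ v → (p w ↔ q (φ w)))
    (hcard : Nat.card {w // p w} = Nat.card {w // q w}) : p v ↔ q (φ v) := by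
  have hq : Nat.card {w // q (φ w)} = Nat.card {w // q w} :=
    Nat.card_congr (φ.subtypeEquiv fun _ => Iff.rfl)
  have hpq : {w | p w}.ncard = {w | q (φ w)}.ncard := hcard.trans hq.symm
  constructor
  · intro hp
    have hsub : {w | q (φ w)} ⊆ {w | p w} := fun w hw => by
      by_cases hwv : w = v
      · exact hwv ▸ hp
      · exact (hne w hwv).2 hw
    have heq := Set.eq_of_subset_of_ncard_le hsub hpq.le
    exact heq.symm.subset hp
  · intro hqv
    have hsub : {w | p w} ⊆ {w | q (φ w)} := fun w hw => by
      by_cases hwv : w = v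
      · exact hwv ▸ hqv
      · exact (hne w hwv).1 hw
    have heq := Set.eq_of_subset_of_ncard_le hsub hpq.ge
    exact heq.symm.subset hqv

/-- Isomorphisms preserve degree triples. -/
lemma degTriple_eq_of_iso {V W : Type*} {D : V → V → Prop} {E : W → W → Prop} (f : V ≃ W)
    (hf : ∀ x y, D x y ↔ E (f x) (f y)) (v : V) : degTriple D v = degTriple E (f v) := by
  simp only [degTriple, aDeg, bDeg, cDeg, Prod.mk.injEq]
  refine ⟨Nat.card_congr (f.subtypeEquiv fun w => ?_),
    Nat.card_congr (f.subtypeEquiv fun w => ?_), Nat.card_congr (f.subtypeEquiv fun w => ?_)⟩ <;>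
  simp only [hf]

/-- If a bijection preserves the arcs between `u` and all vertices other than `v`, as well as the
degree triple of `u`, then it preserves the arcs between `u` and `v`. -/
lemma arcs_iff_of_degTriple_eq {V W : Type*} [Finite V] {D : V → V → Prop} {E : W → W → Prop}
    (φ : V ≃ W) (u v : V)
    (hne : ∀ w, w ≠ v → (D u w ↔ E (φ u) (φ w)) ∧ (D w u ↔ E (φ w) (φ u)))
    (hdt : degTriple D u = degTriple E (φ u)) :
    (D u v ↔ E (φ u) (φ v)) ∧ (D v u ↔ E (φ v) (φ u)) := by
  simp only [degTriple, aDeg, bDeg, cDeg, Prod.mk.injEq] at hdt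
  obtain ⟨ha, hb, hc⟩ := hdt
  have a := iff_apply_of_card_eq φ v (fun w hw => by rw [(hne w hw).1, (hne w hw).2]) ha
  have b := iff_apply_of_card_eq φ v (fun w hw => by rw [(hne w hw).1, (hne w hw).2]) hb
  have c := iff_apply_of_card_eq φ v (fun w hw => by rw [(hne w hw).1, (hne w hw).2]) hc
  tauto

lemma delPair_iff {V : Type*} (D : V → V → Prop) (u v x y : V) :
    delPair D u v x y ↔ D x y ∧ ¬((x = u ∧ y = v) ∨ (x = v ∧ y = u)) := Iff.rfl

/-- A bijection carrying `{u₁, v₁}` onto `{u₂, v₂}` carries the ordered pairs of endpoints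
of the first pair onto those of the second. -/
lemma pair_iff_of_image_eq {V W : Type*} (φ : V ≃ W) {u₁ v₁ : V} {u₂ v₂ : W}
    (h : ({φ u₁, φ v₁} : Set W) = {u₂, v₂}) (x y : V) :
    ((φ x = u₂ ∧ φ y = v₂) ∨ (φ x = v₂ ∧ φ y = u₂)) ↔
      ((x = u₁ ∧ y = v₁) ∨ (x = v₁ ∧ y = u₁)) := by
  rcases Set.pair_eq_pair_iff.1 h with ⟨rfl, rfl⟩ | ⟨rfl, rfl⟩ <;>
  simp only [EmbeddingLike.apply_eq_iff_eq]
  exact or_comm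

/-- Theorem 5.2: for digraphs `H₁`, `H₂` da-hypomorphic to `G`, with distinguished pairs
`u₁ ≠ v₁` and `u₂ ≠ v₂` and `Pᵢ = Hᵢ` minus all arcs between `uᵢ` and `vᵢ`, there is an
isomorphism `H₁ ≅ H₂` carrying `{u₁, v₁}` onto `{u₂, v₂}` iff there is an isomorphism
`P₁ ≅ P₂` carrying `{u₁, v₁}` onto `{u₂, v₂}` and preserving the degree triples (in
`H₁`, `H₂`) of `u₁` and `v₁`. -/
theorem stmt12 {n : ℕ} (G H₁ H₂ : Fin n → Fin n → Prop)
    (hG : Irreflexive G) (hH₁ : Irreflexive H₁) (hH₂ : Irreflexive H₂)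
    (hda₁ : DaHypomorphic H₁ G) (hda₂ : DaHypomorphic H₂ G)
    (u₁ v₁ : Fin n) (h₁ : u₁ ≠ v₁) (u₂ v₂ : Fin n) (h₂ : u₂ ≠ v₂) :
    (∃ ψ : Fin n ≃ Fin n, (∀ x y, H₁ x y ↔ H₂ (ψ x) (ψ y)) ∧
        ({ψ u₁, ψ v₁} : Set (Fin n)) = {u₂, v₂}) ↔
    (∃ φ : Fin n ≃ Fin n,
        (∀ x y, delPair H₁ u₁ v₁ x y ↔ delPair H₂ u₂ v₂ (φ x) (φ y)) ∧
        ({φ u₁, φ v₁} : Set (Fin n)) = {u₂, v₂} ∧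
        degTriple H₁ u₁ = degTriple H₂ (φ u₁) ∧
        degTriple H₁ v₁ = degTriple H₂ (φ v₁)) := by
  constructor
  · rintro ⟨ψ, hψ, hset⟩
    refine ⟨ψ, fun x y => ?_, hset, degTriple_eq_of_iso ψ hψ u₁, degTriple_eq_of_iso ψ hψ v₁⟩
    rw [delPair_iff, delPair_iff, pair_iff_of_image_eq ψ hset, hψ]
  · rintro ⟨φ, hφ, hset, hu, -⟩
    have hout : ∀ x y, ¬((x = u₁ ∧ y = v₁) ∨ (x = v₁ ∧ y = u₁)) →
        (H₁ x y ↔ H₂ (φ x) (φ y)) := fun x y hxy => by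
      have := hφ x y
      rw [delPair_iff, delPair_iff, pair_iff_of_image_eq φ hset] at this
      simpa only [hxy, not_false_eq_true, and_true] using this
    have huv := arcs_iff_of_degTriple_eq φ u₁ v₁
      (fun w hw => ⟨hout _ _ (by tauto), hout _ _ (by tauto)⟩) hu
    refine ⟨φ, fun x y => ?_, hset⟩
    by_cases hxy : (x = u₁ ∧ y = v₁) ∨ (x = v₁ ∧ y = u₁)
    · rcases hxy with ⟨rfl, rfl⟩ | ⟨rfl, rfl⟩
      · exact huv.1
      · exact huv.2
    · exact hout x y hxy
end

section
/- Let H₁ and H₂ be hypomorphic simple graphs on n ≥ 3 vertices. Let u₁ ≠ v₁ be vertices of H₁ and u₂ ≠ v₂ be vertices of H₂, and let Pᵢ denote Hᵢ with the edge uᵢvᵢ deleted if it is present (i = 1, 2). Then there exists an isomorphism ψ from H₁ to H₂ with ψ({u₁, v₁}) = {u₂, v₂} if and only if there exists an isomorphism φ from P₁ to P₂ with φ({u₁, v₁}) = {u₂, v₂} satisfying deg_{H₁}(x) = deg_{H₂}(φ(x)) for each x ∈ {u₁, v₁}. -/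
/-- The degree of a vertex is the cardinality of its neighbor set. -/
theorem degC_eq_ncard_neighborSet {V : Type*} (G : SimpleGraph V) (v : V) :
    degC G v = (G.neighborSet v).ncard := rfl

/-- Graph isomorphisms preserve degrees. -/
theorem degC_apply_iso {V W : Type*} {G : SimpleGraph V} {H : SimpleGraph W} (e : G ≃g H)
    (v : V) : degC H (e v) = degC G v :=
  (Nat.card_congr (e.toEquiv.subtypeEquiv fun _ => e.map_adj_iff.symm)).symm

open scoped Classical in
/-- Deleting the edge `uv` lowers the degree of `u` by one exactly when that edge is present. -/
theorem degC_eq_degC_deleteEdges_add {V : Type*} [Finite V] (G : SimpleGraph V) (u v : V) :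
    degC G u = degC (G.deleteEdges {s(u, v)}) u + if G.Adj u v then 1 else 0 := by
  have hset : (G.deleteEdges {s(u, v)}).neighborSet u = G.neighborSet u \ {v} := by
    ext x
    simp only [SimpleGraph.mem_neighborSet, SimpleGraph.deleteEdges_adj, Set.mem_sdiff,
      Set.mem_singleton_iff, Sym2.congr_right]
  rw [degC_eq_ncard_neighborSet, degC_eq_ncard_neighborSet, hset]
  split_ifs with h
  · exact (Set.ncard_sdiff_singleton_add_one (s := G.neighborSet u) h).symm
  · rw [Set.sdiff_singleton_eq_self (s := G.neighborSet u) h, add_zero]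

/-- Adjacency in a graph, recovered from the graph with one possible edge `uv` deleted. -/
theorem adj_iff_deleteEdges_adj_or {V : Type*} (G : SimpleGraph V) (u v a b : V) :
    G.Adj a b ↔ (G.deleteEdges {s(u, v)}).Adj a b ∨ s(a, b) = s(u, v) ∧ G.Adj u v := by
  rw [SimpleGraph.deleteEdges_adj, Set.mem_singleton_iff]
  by_cases h : s(a, b) = s(u, v)
  · have : G.Adj a b ↔ G.Adj u v := by
      rw [← SimpleGraph.mem_edgeSet, h, SimpleGraph.mem_edgeSet]
    simp [h, this]
  · simp [h]

/-- An equivalence identifies unordered pairs exactly when it identifies their images. -/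
theorem sym2_mk_apply_eq_iff {V W : Type*} (e : V ≃ W) (a b u v : V) :
    s(e a, e b) = s(e u, e v) ↔ s(a, b) = s(u, v) := by
  simp only [Sym2.eq_iff, e.apply_eq_iff_eq]

/-- Two-element sets determine the corresponding unordered pairs. -/
theorem sym2_mk_eq_of_pair_eq {V : Type*} {a b c d : V} (h : ({a, b} : Set V) = {c, d}) :
    s(a, b) = s(c, d) :=
  Sym2.eq_iff.2 (Set.pair_eq_pair_iff.1 h)

/-- Theorem 5.2, graph case: for hypomorphic graphs `H₁`, `H₂` on `n ≥ 3` vertices, with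
distinguished pairs `u₁ ≠ v₁`, `u₂ ≠ v₂` and `Pᵢ = Hᵢ` minus the edge `uᵢvᵢ` (if present),
there is an isomorphism `H₁ ≅ H₂` carrying `{u₁, v₁}` onto `{u₂, v₂}` iff there is an
isomorphism `P₁ ≅ P₂` carrying `{u₁, v₁}` onto `{u₂, v₂}` and preserving the degrees
(in `H₁`, `H₂`) of `u₁` and `v₁`. -/
theorem stmt13 {n : ℕ} (hn : 3 ≤ n) (H₁ H₂ : SimpleGraph (Fin n))
    (hGH : GHypomorphic H₁ H₂)
    (u₁ v₁ : Fin n) (h₁ : u₁ ≠ v₁) (u₂ v₂ : Fin n) (h₂ : u₂ ≠ v₂) :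
    (∃ ψ : H₁ ≃g H₂, ({ψ u₁, ψ v₁} : Set (Fin n)) = {u₂, v₂}) ↔
    (∃ φ : H₁.deleteEdges {s(u₁, v₁)} ≃g H₂.deleteEdges {s(u₂, v₂)},
        ({φ u₁, φ v₁} : Set (Fin n)) = {u₂, v₂} ∧
        degC H₁ u₁ = degC H₂ (φ u₁) ∧
        degC H₁ v₁ = degC H₂ (φ v₁)) := by
  constructor
  · rintro ⟨ψ, hψ⟩
    refine ⟨⟨ψ.toEquiv, fun {a b} => ?_⟩, hψ, (degC_apply_iso ψ u₁).symm,
      (degC_apply_iso ψ v₁).symm⟩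
    rw [← sym2_mk_eq_of_pair_eq hψ, SimpleGraph.deleteEdges_adj, SimpleGraph.deleteEdges_adj,
      Set.mem_singleton_iff, Set.mem_singleton_iff]
    exact and_congr ψ.map_adj_iff (not_congr (sym2_mk_apply_eq_iff ψ.toEquiv a b u₁ v₁))
  · rintro ⟨φ, hφ, hu, -⟩
    have hpair := sym2_mk_eq_of_pair_eq hφ
    have hedge : H₂.Adj (φ u₁) (φ v₁) ↔ H₁.Adj u₁ v₁ := by
      classical
      have hdeg := degC_apply_iso φ u₁
      rw [degC_eq_degC_deleteEdges_add H₁ u₁ v₁,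
        degC_eq_degC_deleteEdges_add H₂ (φ u₁) (φ v₁), hpair, hdeg] at hu
      split_ifs at hu <;> first | omega | simp_all
    refine ⟨⟨φ.toEquiv, fun {a b} => ?_⟩, hφ⟩
    rw [adj_iff_deleteEdges_adj_or H₁ u₁ v₁, adj_iff_deleteEdges_adj_or H₂ (φ u₁) (φ v₁), hedge]
    refine or_congr ?_ (and_congr_left' (sym2_mk_apply_eq_iff φ.toEquiv a b u₁ v₁))
    rw [hpair]
    exact φ.map_adj_iff
end

section
/- Let G and H be hypomorphic simple graphs on n ≥ 3 vertices. Then G is isomorphic to H if and only if there exist distinct vertices u, v of G and distinct vertices u′, v′ of H together with an isomorphism φ from the graph obtained from G by deleting the edge uv (if present) to the graph obtained from H by deleting the edge u′v′ (if present), such that φ(u) = u′ and φ(v) = v′ (i.e., if and only if a pair of cards in their common deck is pasted isomorphically in both G and H). -/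
open Classical in
/-- The ordered pairs of adjacent vertices of a graph. -/
noncomputable def adjPairs {V : Type*} [Fintype V] (G : SimpleGraph V) : Finset (V × V) :=
  Finset.univ.filter fun p => G.Adj p.1 p.2

theorem mem_adjPairs {V : Type*} [Fintype V] (G : SimpleGraph V) (p : V × V) :
    p ∈ adjPairs G ↔ G.Adj p.1 p.2 := by
  simp [adjPairs]

/-- An edge-preserving bijection between finite graphs with equally many edges is an
isomorphism. -/
theorem nonempty_iso_of_card_adjPairs_eq {V W : Type*} [Fintype V] [Fintype W]
    {G : SimpleGraph V} {H : SimpleGraph W} (φ : V ≃ W)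
    (hφ : ∀ a b, G.Adj a b → H.Adj (φ a) (φ b))
    (hcard : (adjPairs G).card = (adjPairs H).card) : Nonempty (G ≃g H) := by
  have hmap : (adjPairs G).map (φ.prodCongr φ).toEmbedding = adjPairs H := by
    apply Finset.eq_of_subset_of_card_le
    · intro p hp
      obtain ⟨q, hq, rfl⟩ := Finset.mem_map.1 hp
      exact (mem_adjPairs H _).2 (hφ _ _ ((mem_adjPairs G _).1 hq))
    · rw [Finset.card_map, hcard]
  refine ⟨⟨φ, fun {a b} => ⟨fun h => ?_, hφ a b⟩⟩⟩
  have hmem : (φ a, φ b) ∈ adjPairs H := (mem_adjPairs H _).2 h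
  rw [← hmap, Finset.mem_map] at hmem
  obtain ⟨⟨c, d⟩, hq, heq⟩ := hmem
  simp only [Equiv.coe_toEmbedding, Equiv.prodCongr_apply, Prod.map_apply, Prod.mk.injEq,
    EmbeddingLike.apply_eq_iff_eq] at heq
  obtain ⟨rfl, rfl⟩ := heq
  exact (mem_adjPairs G _).1 hq

/-- Isomorphic vertex-deleted subgraphs have equally many ordered pairs of adjacent vertices. -/
theorem card_filter_adjPairs_eq_of_iso {V W : Type*} [Fintype V] [Fintype W] [DecidableEq V]
    [DecidableEq W] {G : SimpleGraph V} {H : SimpleGraph W} {v : V} {w : W}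
    (e : G.induce ({x | x ≠ v} : Set V) ≃g H.induce ({y | y ≠ w} : Set W)) :
    ((adjPairs G).filter fun p => p.1 ≠ v ∧ p.2 ≠ v).card =
      ((adjPairs H).filter fun p => p.1 ≠ w ∧ p.2 ≠ w).card := by
  refine Finset.card_bij
    (fun p hp => ((e ⟨p.1, (Finset.mem_filter.1 hp).2.1⟩ : W),
      (e ⟨p.2, (Finset.mem_filter.1 hp).2.2⟩ : W))) ?_ ?_ ?_
  · intro p hp
    refine Finset.mem_filter.2 ⟨(mem_adjPairs H _).2 ?_, (e _).2, (e _).2⟩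
    have hadj := (mem_adjPairs G p).1 (Finset.mem_filter.1 hp).1
    exact e.map_adj_iff.2 (show (G.induce _).Adj ⟨p.1, _⟩ ⟨p.2, _⟩ from hadj)
  · rintro ⟨a, b⟩ hp ⟨c, d⟩ hq h
    simpa [← Subtype.ext_iff] using h
  · rintro ⟨c, d⟩ hq
    obtain ⟨hadj, hc, hd⟩ := Finset.mem_filter.1 hq
    refine ⟨((e.symm ⟨c, hc⟩ : V), (e.symm ⟨d, hd⟩ : V)), Finset.mem_filter.2
      ⟨(mem_adjPairs G _).2 ?_, (e.symm _).2, (e.symm _).2⟩, by simp⟩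
    exact e.symm.map_adj_iff.2
      (show (H.induce _).Adj ⟨c, _⟩ ⟨d, _⟩ from (mem_adjPairs H _).1 hadj)

/-- Each adjacent pair survives in all but two of the vertex-deleted subgraphs. -/
theorem sum_card_filter_adjPairs {V : Type*} [Fintype V] [DecidableEq V] (G : SimpleGraph V) :
    ∑ v, ((adjPairs G).filter fun p => p.1 ≠ v ∧ p.2 ≠ v).card =
      (adjPairs G).card * (Fintype.card V - 2) := by
  rw [← smul_eq_mul, ← Finset.sum_const]
  simp_rw [Finset.card_filter]
  rw [Finset.sum_comm]
  refine Finset.sum_congr rfl fun p hp => ?_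
  have hne : p.1 ≠ p.2 := ((mem_adjPairs G p).1 hp).ne
  rw [← Finset.card_filter, ← Finset.card_pair hne, ← Finset.card_compl]
  congr 1
  ext v
  simp [eq_comm]

theorem GHypomorphic.card_adjPairs_eq {n : ℕ} (hn : 3 ≤ n) {G H : SimpleGraph (Fin n)}
    (hGH : GHypomorphic G H) : (adjPairs G).card = (adjPairs H).card := by
  obtain ⟨σ, hσ⟩ := hGH
  have hsum := sum_card_filter_adjPairs G
  rw [Finset.sum_congr rfl fun v _ => card_filter_adjPairs_eq_of_iso (hσ v).some,
    Equiv.sum_comp σ fun w => ((adjPairs H).filter fun p => p.1 ≠ w ∧ p.2 ≠ w).card,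
    sum_card_filter_adjPairs H, Fintype.card_fin] at hsum
  exact (Nat.eq_of_mul_eq_mul_right (by omega) hsum).symm

/-- Theorem 5.8, graph case: hypomorphic graphs `G` and `H` on `n ≥ 3` vertices are
isomorphic iff a pair of cards in their common deck is pasted isomorphically in both:
there are distinct `u, v` in `G` and distinct `u', v'` in `H` and an isomorphism from
`G` minus the edge `uv` (if present) to `H` minus the edge `u'v'` (if present) sending
`u ↦ u'` and `v ↦ v'`. -/
theorem stmt17 {n : ℕ} (hn : 3 ≤ n) (G H : SimpleGraph (Fin n))
    (hGH : GHypomorphic G H) :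
    Nonempty (G ≃g H) ↔
    ∃ u v : Fin n, u ≠ v ∧ ∃ u' v' : Fin n, u' ≠ v' ∧
      ∃ φ : G.deleteEdges {s(u, v)} ≃g H.deleteEdges {s(u', v')},
        φ u = u' ∧ φ v = v' := by
  constructor
  · rintro ⟨φ⟩
    have huv : (⟨0, by omega⟩ : Fin n) ≠ ⟨1, by omega⟩ := by simp
    refine ⟨_, _, huv, _, _, φ.injective.ne huv, ⟨φ.toEquiv, fun {a b} => ?_⟩, rfl, rfl⟩
    have hpair (c d : Fin n) : s(φ a, φ b) = s(φ c, φ d) ↔ s(a, b) = s(c, d) := by simp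
    rw [SimpleGraph.deleteEdges_adj, SimpleGraph.deleteEdges_adj]
    exact and_congr φ.map_adj_iff (not_congr (hpair _ _))
  · rintro ⟨u, v, -, u', v', -, φ, hu, hv⟩
    have hcard := hGH.card_adjPairs_eq hn
    have hpair (a b : Fin n) : s(φ a, φ b) = s(u', v') ↔ s(a, b) = s(u, v) := by
      simp [← hu, ← hv]
    have hadj (a b : Fin n) (hab : s(a, b) ≠ s(u, v)) : H.Adj (φ a) (φ b) ↔ G.Adj a b := by
      have h := φ.map_adj_iff (v := a) (w := b)
      simpa only [SimpleGraph.deleteEdges_adj, Set.mem_singleton_iff, hpair, hab,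
        not_false_eq_true, and_true] using h
    by_cases hH : H.Adj u' v'
    · refine nonempty_iso_of_card_adjPairs_eq φ.toEquiv (fun a b h => ?_) hcard
      by_cases hab : s(a, b) = s(u, v)
      · rwa [← SimpleGraph.mem_edgeSet, ← (hpair a b).2 hab] at hH
      · exact (hadj a b hab).2 h
    · refine (nonempty_iso_of_card_adjPairs_eq φ.toEquiv.symm (fun c d h => ?_) hcard.symm).map
        SimpleGraph.Iso.symm
      obtain ⟨a, rfl⟩ := φ.toEquiv.surjective c
      obtain ⟨b, rfl⟩ := φ.toEquiv.surjective d
      simp only [Equiv.symm_apply_apply]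
      refine (hadj a b fun hab => hH ?_).1 h
      rw [← SimpleGraph.mem_edgeSet, ← (hpair a b).2 hab]
      exact h
end

section
/- Let G and H be hypomorphic simple graphs on n ≥ 3 vertices. Suppose there exist distinct vertices u, v of G and distinct vertices u′, v′ of H and an isomorphism from the graph obtained from G by deleting the edge uv (if present) to the graph obtained from H by deleting the edge u′v′ (if present) sending u to u′ and v to v′. Then for every pair of distinct vertices x, y of G there exist distinct vertices x′, y′ of H and an isomorphism from the graph obtained from G by deleting the edge xy (if present) to the graph obtained from H by deleting the edge x′y′ (if present) sending x to x′ and y to y′. (That is: if one pair of cards is pasted isomorphically in G and H, then every pair of cards is pasted isomorphically in G and H.) -/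
open Finset in
/-- Each edge survives in all cards but the two of its endpoints. -/
theorem SimpleGraph.sum_card_edgeFinset_induce_compl_singleton {V : Type*} [Fintype V]
    [DecidableEq V] (G : SimpleGraph V) [DecidableRel G.Adj] :
    ∑ v, #(G.induce {v}ᶜ).edgeFinset + 2 * #G.edgeFinset =
      Fintype.card V * #G.edgeFinset := by
  rw [← G.sum_degrees_eq_twice_card_edges, ← Finset.sum_add_distrib, ← smul_eq_mul,
    ← Finset.card_univ, ← Finset.sum_const]
  refine Finset.sum_congr rfl fun v _ ↦ ?_
  rw [card_edgeFinset_induce_compl_singleton, card_edgeFinset_deleteIncidenceSet]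
  refine Nat.sub_add_cancel ?_
  rw [← card_incidenceFinset_eq_degree]
  exact card_le_card (G.incidenceFinset_subset v)

open Finset in
open scoped Classical in
/-- Hypomorphic graphs on at least three vertices have equally many edges. -/
theorem GHypomorphic.card_edgeFinset_eq {n : ℕ} (hn : 3 ≤ n) {G H : SimpleGraph (Fin n)}
    (h : GHypomorphic G H) : #G.edgeFinset = #H.edgeFinset := by
  obtain ⟨σ, hσ⟩ := h
  have hsum : ∑ v, #(G.induce {v}ᶜ).edgeFinset = ∑ v, #(H.induce {v}ᶜ).edgeFinset := by
    rw [← Equiv.sum_comp σ fun v ↦ #(H.induce {v}ᶜ).edgeFinset]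
    refine Finset.sum_congr rfl fun v _ ↦ ?_
    obtain ⟨e⟩ := hσ v
    have e' : G.induce {v}ᶜ ≃g H.induce {σ v}ᶜ := e
    exact e'.card_edgeFinset_eq
  have hG := G.sum_card_edgeFinset_induce_compl_singleton
  have hH := H.sum_card_edgeFinset_induce_compl_singleton
  rw [Fintype.card_fin] at hG hH
  obtain ⟨k, rfl⟩ := Nat.exists_eq_add_of_le hn
  have hmul : (1 + k) * #G.edgeFinset = (1 + k) * #H.edgeFinset := by linarith
  exact Nat.eq_of_mul_eq_mul_left (by omega) hmul

open Finset in
theorem SimpleGraph.card_edgeFinset_deleteEdges_singleton_add {V : Type*} [DecidableEq V]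
    (G : SimpleGraph V) [DecidableRel G.Adj] [Fintype G.edgeSet] (u v : V)
    [Fintype (G.deleteEdges {s(u, v)}).edgeSet] :
    #(G.deleteEdges {s(u, v)}).edgeFinset + (if G.Adj u v then 1 else 0) = #G.edgeFinset := by
  have h : (G.deleteEdges {s(u, v)}).edgeFinset = G.edgeFinset.erase s(u, v) := by
    ext e
    simp [and_comm]
  rw [h]
  split_ifs with huv
  · exact card_erase_add_one (by simpa using huv)
  · rw [erase_eq_of_notMem (by simpa using huv), add_zero]

/-- An isomorphism of edge-deleted graphs that matches the deleted pairs is an isomorphism of the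
original graphs as soon as the deleted pairs are both edges or both non-edges. -/
theorem SimpleGraph.adj_iff_adj_of_iso_deleteEdges {V W : Type*} {G : SimpleGraph V}
    {H : SimpleGraph W} {u v : V} {u' v' : W}
    (φ : G.deleteEdges {s(u, v)} ≃g H.deleteEdges {s(u', v')}) (hu : φ u = u') (hv : φ v = v')
    (h : G.Adj u v ↔ H.Adj u' v') (a b : V) : H.Adj (φ a) (φ b) ↔ G.Adj a b := by
  have hmap := φ.map_adj_iff (v := a) (w := b)
  have hpair : s(φ a, φ b) = s(u', v') ↔ s(a, b) = s(u, v) := by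
    simp [← hu, ← hv]
  rw [deleteEdges_adj, deleteEdges_adj, Set.mem_singleton_iff, Set.mem_singleton_iff,
    hpair] at hmap
  by_cases hab : s(a, b) = s(u, v)
  · rw [← mem_edgeSet, ← mem_edgeSet, hpair.2 hab, hab]
    exact h.symm
  · simpa [hab] using hmap

/-- Corollary 5.9 / Theorem 5.11, graph case: if `G` and `H` are hypomorphic graphs on
`n ≥ 3` vertices and one pair of cards is pasted isomorphically in `G` and `H` (there
are distinct `u, v` and distinct `u', v'` and an isomorphism from `G` minus the edge
`uv` to `H` minus the edge `u'v'` sending `u ↦ u'`, `v ↦ v'`), then every pair of cards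
is pasted isomorphically in `G` and `H`. -/
theorem stmt18 {n : ℕ} (hn : 3 ≤ n) (G H : SimpleGraph (Fin n))
    (hGH : GHypomorphic G H)
    (hone : ∃ u v : Fin n, u ≠ v ∧ ∃ u' v' : Fin n, u' ≠ v' ∧
      ∃ φ : G.deleteEdges {s(u, v)} ≃g H.deleteEdges {s(u', v')},
        φ u = u' ∧ φ v = v') :
    ∀ x y : Fin n, x ≠ y → ∃ x' y' : Fin n, x' ≠ y' ∧
      ∃ φ : G.deleteEdges {s(x, y)} ≃g H.deleteEdges {s(x', y')},
        φ x = x' ∧ φ y = y' := by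
  classical
  obtain ⟨u, v, -, u', v', -, φ, hu, hv⟩ := hone
  have hcard := hGH.card_edgeFinset_eq hn
  rw [← G.card_edgeFinset_deleteEdges_singleton_add u v,
    ← H.card_edgeFinset_deleteEdges_singleton_add u' v',
    SimpleGraph.Iso.card_edgeFinset_eq φ] at hcard
  have huv : G.Adj u v ↔ H.Adj u' v' := by
    by_cases hG : G.Adj u v <;> by_cases hH : H.Adj u' v' <;> simp_all
  have hadj := SimpleGraph.adj_iff_adj_of_iso_deleteEdges φ hu hv huv
  intro x y hxy
  refine ⟨φ x, φ y, φ.injective.ne hxy, ⟨φ.toEquiv, fun {a b} ↦ ?_⟩, rfl, rfl⟩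
  simp only [SimpleGraph.deleteEdges_adj, Set.mem_singleton_iff]
  exact and_congr (hadj a b) (by simp)
end
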